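/- Suppose ρ₁ ≠ ρ₂ and c'' = c/(ρ₁⁻¹ − ρ₂⁻¹) = c₁/c₂ ∈ E_a with integers c₁, c₂, gcd(c₁, c₂) = 1, where c₂ = p^ℓ·m for some ℓ ∈ ℕ and integer m with p ∤ m. Then μ_{M,D} is a spectral measure if and only if ρ₁⁻¹ and ρ₂⁻¹ are integers divisible by p and p^{ℓ+1} divides ρ₁⁻¹ − ρ₂⁻¹. -/

import Mathlib

open MeasureTheory Complex Matrix
open scoped ENNReal

noncomputable section

/-- The exponential function `e_λ(x) = e^{-2πi⟨λ,x⟩}` on `ℝ²`. -/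
def expChar (lam x : Fin 2 → ℝ) : ℂ :=
  Complex.exp ((-2 * Real.pi * Complex.I) * ((lam 0 * x 0 + lam 1 * x 1 : ℝ) : ℂ))

/-- The Fourier transform `μ̂(ξ) = ∫ e^{-2πi⟨ξ,x⟩} dμ(x)` of a measure on `ℝ²`. -/
def ftMeasure (μ : Measure (Fin 2 → ℝ)) (ξ : Fin 2 → ℝ) : ℂ :=
  ∫ x, expChar ξ x ∂μ

/-- The mask `m_D(ξ) = (1/p) Σ_{d∈D} e^{-2πi⟨ξ,d⟩}` of a digit system `D : Fin p → ℝ²`. -/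
def mask {p : ℕ} (D : Fin p → (Fin 2 → ℝ)) (ξ : Fin 2 → ℝ) : ℂ :=
  (p : ℂ)⁻¹ * ∑ i : Fin p, expChar ξ (D i)

/-- Integer digits, coerced to real vectors. -/
def digitR {p : ℕ} (D : Fin p → (Fin 2 → ℤ)) : Fin p → (Fin 2 → ℝ) :=
  fun i j => (D i j : ℝ)

/-- `μ` is the self-affine measure of the IFS `φ_d(x) = M⁻¹(x+d)`, `d ∈ D`:
a compactly supported Borel probability measure with `μ = (1/#D) Σ_d μ ∘ φ_d⁻¹`. -/
def IsSelfAffine {p : ℕ} (μ : Measure (Fin 2 → ℝ)) (M : Matrix (Fin 2) (Fin 2) ℝ)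
    (D : Fin p → (Fin 2 → ℝ)) : Prop :=
  IsProbabilityMeasure μ ∧ (∃ K : Set (Fin 2 → ℝ), IsCompact K ∧ μ Kᶜ = 0) ∧
  μ = (p : ℝ≥0∞)⁻¹ • ∑ i : Fin p, μ.map (fun x => M⁻¹.mulVec (x + D i))

/-- `Λ` is an orthogonal set of exponentials for `μ`. -/
def IsOrthoSet (μ : Measure (Fin 2 → ℝ)) (Λ : Set (Fin 2 → ℝ)) : Prop :=
  ∀ l ∈ Λ, ∀ l' ∈ Λ, l ≠ l' → ftMeasure μ (l - l') = 0

/-- `μ` is a spectral measure: some countable set of exponentials forms an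
orthonormal (Hilbert) basis of `L²(μ)`. -/
def IsSpectral (μ : Measure (Fin 2 → ℝ)) : Prop :=
  ∃ Λ : Set (Fin 2 → ℝ), Λ.Countable ∧
    ∃ b : HilbertBasis Λ ℂ (Lp ℂ 2 μ),
      ∀ lam : Λ, ⇑(b lam) =ᵐ[μ] expChar (lam : Fin 2 → ℝ)

/-- The standing assumption on the digit set: `a = (a₁,a₂)` has entries in `[1,p-1]`
and `Z(m_D) = ⋃_{j=1}^{p-1} (j·a/p + ℤ²)`. -/
def ZeroSetCond (p : ℕ) (D : Fin p → (Fin 2 → ℤ)) (a : Fin 2 → ℤ) : Prop :=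
  (∀ i, 1 ≤ a i ∧ a i ≤ (p : ℤ) - 1) ∧
  ∀ ξ : Fin 2 → ℝ, mask (digitR D) ξ = 0 ↔
    ∃ j : ℕ, 1 ≤ j ∧ j ≤ p - 1 ∧ ∃ k : Fin 2 → ℤ,
      ∀ i, ξ i = (j : ℝ) * (a i : ℝ) / p + (k i : ℝ)

/-- The upper-triangular expanding matrix `M = [[ρ₁⁻¹, c],[0, ρ₂⁻¹]]`. -/
def Mupper (ρ₁ ρ₂ c : ℝ) : Matrix (Fin 2) (Fin 2) ℝ := !![ρ₁⁻¹, c; 0, ρ₂⁻¹]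

/-- The set `E_a = {h/l : gcd(h,l)=1, l·a₂ − h·a₁ ∈ ℤ∖pℤ} ∪ {0}`. -/
def Ea (p : ℕ) (a : Fin 2 → ℤ) : Set ℝ :=
  {x | ∃ h l : ℤ, Int.gcd h l = 1 ∧ ¬ ((p : ℤ) ∣ (l * a 1 - h * a 0)) ∧
    x = (h : ℝ) / (l : ℝ)} ∪ {0}


section

/-- the plane -/
abbrev V2 := Fin 2 → ℝ

lemma expChar_norm (l x : V2) : ‖expChar l x‖ = 1 := by
  unfold expChar
  rw [Complex.norm_exp]
  simp

lemma expChar_zero_left (x : V2) : expChar 0 x = 1 := by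
  simp [expChar]

lemma expChar_zero_right (x : V2) : expChar x 0 = 1 := by
  simp [expChar]

lemma expChar_add_left (l l' x : V2) : expChar (l + l') x = expChar l x * expChar l' x := by
  unfold expChar
  rw [← Complex.exp_add]
  congr 1
  simp only [Pi.add_apply]
  push_cast
  ring

lemma expChar_add_right (l x y : V2) : expChar l (x + y) = expChar l x * expChar l y := by
  unfold expChar
  rw [← Complex.exp_add]
  congr 1
  simp only [Pi.add_apply]
  push_cast
  ring

lemma expChar_neg_left (l x : V2) : expChar (-l) x = starRingEnd ℂ (expChar l x) := by
  unfold expChar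
  rw [← Complex.exp_conj]
  congr 1
  simp only [Pi.neg_apply, map_mul, Complex.conj_ofReal, map_neg, Complex.conj_I, map_ofNat]
  push_cast
  ring

lemma expChar_continuous (l : V2) : Continuous (expChar l) := by
  unfold expChar
  fun_prop

lemma expChar_continuous_left (x : V2) : Continuous (fun l => expChar l x) := by
  unfold expChar
  fun_prop

lemma expChar_integrable (ν : Measure V2) [IsFiniteMeasure ν] (l : V2) :
    Integrable (expChar l) ν := by
  refine Integrable.of_bound (expChar_continuous l).aestronglyMeasurable 1 ?_
  exact Filter.Eventually.of_forall fun x => (expChar_norm l x).le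

lemma expChar_memLp (ν : Measure V2) [IsFiniteMeasure ν] (l : V2) :
    MemLp (expChar l) 2 ν := by
  refine MemLp.of_bound (expChar_continuous l).aestronglyMeasurable 1 ?_
  exact Filter.Eventually.of_forall fun x => (expChar_norm l x).le

lemma ft_zero (ν : Measure V2) [IsProbabilityMeasure ν] : ftMeasure ν 0 = 1 := by
  simp [ftMeasure, expChar_zero_left]

lemma ft_neg (ν : Measure V2) (ξ : V2) : ftMeasure ν (-ξ) = starRingEnd ℂ (ftMeasure ν ξ) := by
  unfold ftMeasure
  rw [← integral_conj]
  simp only [expChar_neg_left]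

lemma ft_norm_le (ν : Measure V2) [IsProbabilityMeasure ν] (ξ : V2) : ‖ftMeasure ν ξ‖ ≤ 1 := by
  unfold ftMeasure
  have := norm_integral_le_of_norm_le_const (μ := ν) (f := expChar ξ) (C := 1)
    (Filter.Eventually.of_forall fun x => (expChar_norm ξ x).le)
  simpa using this

/-- exponential as an `L²` element -/
def eLp (ν : Measure V2) [IsFiniteMeasure ν] (l : V2) : Lp ℂ 2 ν := (expChar_memLp ν l).toLp

lemma eLp_coe (ν : Measure V2) [IsFiniteMeasure ν] (l : V2) : ⇑(eLp ν l) =ᵐ[ν] expChar l :=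
  (expChar_memLp ν l).coeFn_toLp

lemma eLp_inner (ν : Measure V2) [IsFiniteMeasure ν] (l l' : V2) :
    inner ℂ (eLp ν l) (eLp ν l') = ftMeasure ν (l' - l) := by
  rw [MeasureTheory.L2.inner_def]
  unfold ftMeasure
  refine integral_congr_ae ?_
  filter_upwards [eLp_coe ν l, eLp_coe ν l'] with x h1 h2
  rw [h1, h2, sub_eq_add_neg, expChar_add_left, expChar_neg_left]
  simp

lemma eLp_norm (ν : Measure V2) [IsProbabilityMeasure ν] (l : V2) : ‖eLp ν l‖ = 1 := by
  have h := eLp_inner ν l l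
  rw [sub_self, ft_zero] at h
  have h2 := inner_self_eq_norm_sq_to_K (𝕜 := ℂ) (eLp ν l)
  rw [h] at h2
  have h3 : ((‖eLp ν l‖ ^ 2 : ℝ) : ℂ) = ((1 : ℝ) : ℂ) := by
    push_cast
    exact h2.symm
  have h4 := Complex.ofReal_injective h3
  have h5 := norm_nonneg (eLp ν l)
  nlinarith

/-- `f` is the Fourier transform of a probability measure -/
def IsFT (f : V2 → ℂ) : Prop :=
  ∃ ν : Measure V2, IsProbabilityMeasure ν ∧ ∀ ξ, f ξ = ftMeasure ν ξ

lemma ft_norm_symm (ν : Measure V2) (ξ : V2) : ‖ftMeasure ν (-ξ)‖ = ‖ftMeasure ν ξ‖ := by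
  rw [ft_neg]; simp

lemma IsFT.bessel {f : V2 → ℂ} (hf : IsFT f) {Λ : Set V2}
    (hΛ : ∀ x ∈ Λ, ∀ y ∈ Λ, x ≠ y → f (x - y) = 0) (ξ : V2) (s : Finset Λ) :
    ∑ x ∈ s, ‖f (ξ + x)‖ ^ 2 ≤ 1 := by
  obtain ⟨ν, hν, hfν⟩ := hf
  have ho : Orthonormal ℂ (fun x : Λ => eLp ν (x : V2)) := by
    refine ⟨fun x => eLp_norm ν _, ?_⟩
    intro x y hxy
    show inner ℂ (eLp ν x) (eLp ν y) = 0
    rw [eLp_inner, ← hfν]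
    exact hΛ y y.2 x x.2 (fun h => hxy (Subtype.ext h.symm))
  have := ho.sum_inner_products_le (eLp ν (-ξ)) (s := s)
  rw [eLp_norm] at this
  refine le_trans (le_of_eq ?_) (this.trans (by norm_num))
  refine Finset.sum_congr rfl fun x _ => ?_
  rw [eLp_inner, hfν, ← ft_norm_symm]
  congr 3
  abel

lemma IsFT.norm_le {f : V2 → ℂ} (hf : IsFT f) (ξ : V2) : ‖f ξ‖ ≤ 1 := by
  obtain ⟨ν, hν, h⟩ := hf
  rw [h]; exact ft_norm_le ν ξ

lemma IsFT.one : IsFT (fun _ => 1) := by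
  refine ⟨Measure.dirac 0, inferInstance, fun ξ => ?_⟩
  simp [ftMeasure, expChar_zero_right]

/-- adjoint of a linear map with respect to the coordinate pairing -/
lemma exists_adj (T : V2 →ₗ[ℝ] V2) : ∃ S : V2 →ₗ[ℝ] V2, ∀ ξ x, expChar (T ξ) x = expChar ξ (S x) := by
  refine ⟨Matrix.toLin' (LinearMap.toMatrix' T)ᵀ, fun ξ x => ?_⟩
  have : T ξ = (LinearMap.toMatrix' T).mulVec ξ := by
    rw [← Matrix.toLin'_apply, Matrix.toLin'_toMatrix']
  rw [this, Matrix.toLin'_apply]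
  unfold expChar
  congr 3
  simp [Matrix.mulVec, dotProduct, Fin.sum_univ_two, Matrix.transpose_apply]
  ring

lemma IsFT.comp {f : V2 → ℂ} (hf : IsFT f) (T : V2 →ₗ[ℝ] V2) : IsFT (fun ξ => f (T ξ)) := by
  obtain ⟨ν, hν, h⟩ := hf
  obtain ⟨S, hS⟩ := exists_adj T
  have hSc : Continuous S := S.continuous_of_finiteDimensional
  refine ⟨ν.map S, Measure.isProbabilityMeasure_map hSc.aemeasurable, fun ξ => ?_⟩
  simp only [h]
  unfold ftMeasure
  rw [integral_map hSc.aemeasurable (expChar_continuous ξ).aestronglyMeasurable]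
  simp only [hS]

lemma ft_avg {p : ℕ} (ν : Fin p → Measure V2) [∀ i, IsFiniteMeasure (ν i)] (ξ : V2) :
    ftMeasure ((p : ℝ≥0∞)⁻¹ • ∑ i : Fin p, ν i) ξ = (p : ℂ)⁻¹ * ∑ i, ftMeasure (ν i) ξ := by
  unfold ftMeasure
  rw [integral_smul_measure, integral_finsetSum_measure]
  · simp
  · intro i _
    exact expChar_integrable _ _

lemma IsFT.mul_mask {f : V2 → ℂ} (hf : IsFT f) {p : ℕ} (hp : p ≠ 0) (D : Fin p → V2)
    (T : V2 →ₗ[ℝ] V2) : IsFT (fun ξ => mask D (T ξ) * f ξ) := by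
  obtain ⟨ν, hν, h⟩ := hf
  obtain ⟨S, hS⟩ := exists_adj T
  have hc : ∀ i, Continuous (fun x : V2 => x + S (D i)) := fun i => by fun_prop
  have hi : ∀ i, IsProbabilityMeasure (ν.map (fun x => x + S (D i))) := fun i =>
    Measure.isProbabilityMeasure_map (hc i).aemeasurable
  refine ⟨(p : ℝ≥0∞)⁻¹ • ∑ i : Fin p, ν.map (fun x => x + S (D i)), ⟨?_⟩, fun ξ => ?_⟩
  · simp only [Measure.smul_apply, Measure.finsetSum_apply, measure_univ, Finset.sum_const,
      Finset.card_univ, Fintype.card_fin, smul_eq_mul, nsmul_eq_mul, mul_one]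
    exact ENNReal.inv_mul_cancel (by exact_mod_cast hp) (by simp)
  · simp only [h]
    rw [ft_avg]
    unfold mask
    rw [mul_assoc, Finset.sum_mul]
    congr 1
    refine Finset.sum_congr rfl fun i _ => ?_
    unfold ftMeasure
    rw [integral_map (hc i).aemeasurable (expChar_continuous ξ).aestronglyMeasurable]
    simp only [expChar_add_right, hS]
    rw [integral_mul_const, mul_comm]

lemma ft_modulus (ν : Measure V2) [IsProbabilityMeasure ν] (ε : ℝ) (hε : 0 < ε) :
    ∀ᶠ h in nhds (0 : V2), ∀ y, ‖ftMeasure ν (y + h) - ftMeasure ν y‖ < ε := by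
  have hc : Continuous (fun h : V2 => ∫ x, ‖expChar h x - 1‖ ∂ν) := by
    refine continuous_of_dominated (bound := fun _ => 2) ?_ ?_ (integrable_const _) ?_
    · intro h
      exact ((expChar_continuous h).sub continuous_const).norm.aestronglyMeasurable
    · intro h
      refine Filter.Eventually.of_forall fun x => ?_
      rw [norm_norm]
      refine (norm_sub_le _ _).trans ?_
      rw [expChar_norm]; norm_num
    · refine Filter.Eventually.of_forall fun x => ?_
      exact ((expChar_continuous_left x).sub continuous_const).norm
  have h0 : (∫ x, ‖expChar (0 : V2) x - 1‖ ∂ν) < ε := by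
    simpa [expChar_zero_left] using hε
  filter_upwards [hc.continuousAt.eventually_lt continuousAt_const h0] with h hh y
  refine lt_of_le_of_lt ?_ hh
  unfold ftMeasure
  rw [← integral_sub (expChar_integrable _ _) (expChar_integrable _ _)]
  refine (norm_integral_le_integral_norm _).trans (le_of_eq ?_)
  refine integral_congr_ae (Filter.Eventually.of_forall fun x => ?_)
  show ‖expChar (y + h) x - expChar y x‖ = ‖expChar h x - 1‖
  rw [expChar_add_left, ← mul_sub_one, norm_mul, expChar_norm, one_mul]

lemma ft_continuous (ν : Measure V2) [IsProbabilityMeasure ν] : Continuous (ftMeasure ν) := by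
  unfold ftMeasure
  refine continuous_of_dominated (bound := fun _ => 1) ?_ ?_ (integrable_const _) ?_
  · intro h
    exact (expChar_continuous h).aestronglyMeasurable
  · intro h
    exact Filter.Eventually.of_forall fun x => (expChar_norm h x).le
  · exact Filter.Eventually.of_forall fun x => expChar_continuous_left x

end

section

/-- Abstract data: `F` is the Fourier transform of the self-affine measure, `m` the mask, `T` the
inverse of the dual matrix. -/
structure Sys (p : ℕ) (m F : V2 → ℂ) (T : V2 →ₗ[ℝ] V2) : Prop where
  hp : p.Prime
  inj : Function.Injective T
  surj : Function.Surjective T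
  ftm : ∀ k, IsFT (fun ξ => ∏ i ∈ Finset.range k, m ((T ^ (i + 1)) ξ))
  ftF : ∀ k, IsFT (fun ξ => (∏ i ∈ Finset.range k, m ((T ^ (i + 1)) ξ)) * F ((T ^ (k + 1)) ξ))
  ftF0 : IsFT F
  m_le : ∀ ξ, ‖m ξ‖ ≤ 1
  recF : ∀ ξ, F ξ = m (T ξ) * F (T ξ)
  zero : ∀ ξ, F ξ = 0 → ∃ n : ℕ, m ((T ^ (n + 1)) ξ) = 0
  cnt : {ξ | m ξ = 0}.Countable
  dif : ∀ ζ₁ ζ₂, m ζ₁ = 0 → m ζ₂ = 0 → m (ζ₁ - ζ₂) = 0 ∨ ∃ k : Fin 2 → ℤ, ∀ i, (ζ₁ - ζ₂) i = k i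
  neg : ∀ ζ, m ζ = 0 → m (-ζ) = 0

/-- An eigenfunctional of the system. -/
structure EigFun (p : ℕ) (m : V2 → ℂ) (T : V2 →ₗ[ℝ] V2) (φ : V2 →ₗ[ℝ] ℝ) (r : ℝ) (q : ℤ) : Prop where
  one_lt : 1 < r
  eig : ∀ ξ, φ (T ξ) = φ ξ / r
  zero : ∀ ζ, m ζ = 0 → ∃ u : ℤ, ¬ (p : ℤ) ∣ u ∧ φ ζ = u / p
  q0 : q ≠ 0
  ne : ∃ v, φ v = 1
  near : ∀ ε : ℝ, 0 < ε → ∃ θ : ℝ, 0 ≤ θ ∧ θ < 1 ∧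
    ∀ ξ, (∀ N : ℤ, ε ≤ |q * φ ξ - N|) → ‖m ξ‖ ≤ θ

/-- Spectrum, in terms of the Fourier transform. -/
structure IsSpec (F : V2 → ℂ) (Λ : Set V2) : Prop where
  bz : ∀ x ∈ Λ, ∀ y ∈ Λ, x ≠ y → F (x - y) = 0
  sum : ∀ ξ, HasSum (fun x : Λ => ‖F (ξ + x)‖ ^ 2) 1

variable {p : ℕ} {m F : V2 → ℂ} {T : V2 →ₗ[ℝ] V2} {φ : V2 →ₗ[ℝ] ℝ} {r : ℝ} {q : ℤ} {Λ : Set V2}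

lemma Sys.F_eq (S : Sys p m F T) (k : ℕ) (ξ : V2) :
    F ξ = (∏ i ∈ Finset.range k, m ((T ^ (i + 1)) ξ)) * F ((T ^ k) ξ) := by
  induction k with
  | zero => simp
  | succ k ih =>
    rw [ih, S.recF ((T ^ k) ξ), Finset.prod_range_succ, ← mul_assoc]
    have : (T ^ (k + 1)) ξ = T ((T ^ k) ξ) := by rw [pow_succ']; rfl
    rw [this]

lemma Sys.F_zero_of (S : Sys p m F T) {n : ℕ} {ξ : V2} (h : m ((T ^ (n + 1)) ξ) = 0) : F ξ = 0 := by
  rw [S.F_eq (n + 1), Finset.prod_range_succ, h]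
  simp

lemma Sys.pow_inj (S : Sys p m F T) (n : ℕ) : Function.Injective (T ^ n) := by
  rw [Module.End.coe_pow]; exact S.inj.iterate n

lemma Sys.pow_surj (S : Sys p m F T) (n : ℕ) : Function.Surjective (T ^ n) := by
  rw [Module.End.coe_pow]; exact S.surj.iterate n

lemma Sys.F_cnt (S : Sys p m F T) : {ξ | F ξ = 0}.Countable := by
  have : {ξ | F ξ = 0} ⊆ ⋃ n : ℕ, (T ^ (n + 1)) ⁻¹' {ξ | m ξ = 0} := by
    intro ξ hξ
    obtain ⟨n, hn⟩ := S.zero ξ hξ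
    exact Set.mem_iUnion.2 ⟨n, hn⟩
  refine Set.Countable.mono this (Set.countable_iUnion fun n => ?_)
  exact S.cnt.preimage_of_injOn (S.pow_inj _).injOn

lemma EigFun.eig_pow (E : EigFun p m T φ r q) (n : ℕ) (ξ : V2) : φ ((T ^ n) ξ) = φ ξ / r ^ n := by
  induction n with
  | zero => simp
  | succ n ih =>
    have : (T ^ (n + 1)) ξ = T ((T ^ n) ξ) := by rw [pow_succ']; rfl
    rw [this, E.eig, ih, pow_succ]
    field_simp

lemma Sys.generic (S : Sys p m F T) (E : EigFun p m T φ r q) (k : ℕ) :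
    ∃ η, F η ≠ 0 ∧ ‖m ((T ^ (k + 1)) η)‖ < 1 := by
  obtain ⟨v, hv⟩ := E.ne
  obtain ⟨θ, -, hθ1, hθ⟩ := E.near (1 / 4) (by norm_num)
  obtain ⟨w, hw⟩ := S.pow_surj (k + 1) v
  have hq : (q : ℝ) ≠ 0 := by exact_mod_cast E.q0
  -- the curve
  let g : ℝ → V2 := fun s => (s / q) • w
  have hw0 : w ≠ 0 := by
    rintro rfl
    rw [map_zero] at hw
    rw [← hw, map_zero] at hv
    norm_num at hv
  have hg : Function.Injective g := by
    intro s t h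
    have h1 : (s / q) • w = (t / q) • w := h
    have h2 := smul_left_injective ℝ hw0 h1
    field_simp at h2
    exact h2
  have hc : (g ⁻¹' {ξ | F ξ = 0}).Countable := S.F_cnt.preimage_of_injOn hg.injOn
  have hunc : ¬ (Set.Ioo (1/4 : ℝ) (3/4)).Countable := by
    rw [← Cardinal.le_aleph0_iff_set_countable, Cardinal.mk_Ioo_real (by norm_num)]
    exact not_le.2 Cardinal.aleph0_lt_continuum
  obtain ⟨s, hs, hs'⟩ : ∃ s ∈ Set.Ioo (1/4 : ℝ) (3/4), s ∉ g ⁻¹' {ξ | F ξ = 0} := by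
    by_contra hcon
    push Not at hcon
    exact hunc (hc.mono hcon)
  refine ⟨g s, hs', lt_of_le_of_lt (hθ _ ?_) hθ1⟩
  intro N
  have : (q : ℝ) * φ ((T ^ (k + 1)) (g s)) = s := by
    simp only [g, map_smul, hw, hv, smul_eq_mul]
    field_simp
  rw [this]
  rcases le_or_gt N 0 with h | h
  · have : (N : ℝ) ≤ 0 := by exact_mod_cast h
    rw [abs_of_nonneg] <;> linarith [hs.1]
  · have : (1 : ℝ) ≤ N := by exact_mod_cast h
    rw [abs_of_nonpos] <;> linarith [hs.2]

lemma IsSpec.nonempty (h : IsSpec F Λ) : Λ.Nonempty := by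
  by_contra hn
  rw [Set.not_nonempty_iff_eq_empty] at hn
  subst hn
  have := (h.sum 0).unique hasSum_empty
  norm_num at this

/-- For every level `k` there is a pair whose only level is `k`. -/
lemma factor (S : Sys p m F T) (E : EigFun p m T φ r q) (h : IsSpec F Λ) (k : ℕ) :
    ∃ x ∈ Λ, ∃ y ∈ Λ, x ≠ y ∧ m ((T ^ (k + 1)) (x - y)) = 0 ∧
      ∀ n, m ((T ^ (n + 1)) (x - y)) = 0 → n = k := by
  suffices hs : ∃ x ∈ Λ, ∃ y ∈ Λ, x ≠ y ∧ ∀ n, m ((T ^ (n + 1)) (x - y)) = 0 → n = k by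
    obtain ⟨x, hx, y, hy, hxy, hn⟩ := hs
    obtain ⟨n, hn'⟩ := S.zero _ (h.bz x hx y hy hxy)
    refine ⟨x, hx, y, hy, hxy, ?_, hn⟩
    rw [← hn n hn']; exact hn'
  by_contra hcon
  push Not at hcon
  set G : V2 → ℂ := fun ξ => (∏ i ∈ Finset.range k, m ((T ^ (i + 1)) ξ)) * F ((T ^ (k + 1)) ξ) with hG
  have hFG : ∀ ξ, F ξ = G ξ * m ((T ^ (k + 1)) ξ) := by
    intro ξ
    rw [S.F_eq (k + 1), Finset.prod_range_succ, hG]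
    ring
  have hGz : ∀ x ∈ Λ, ∀ y ∈ Λ, x ≠ y → G (x - y) = 0 := by
    intro x hx y hy hxy
    obtain ⟨n, hn, hnk⟩ := hcon x hx y hy hxy
    rcases lt_or_gt_of_ne hnk with h1 | h1
    · have : ∏ i ∈ Finset.range k, m ((T ^ (i + 1)) (x - y)) = 0 :=
        Finset.prod_eq_zero (Finset.mem_range.2 h1) hn
      simp only [hG, this, zero_mul]
    · have : F ((T ^ (k + 1)) (x - y)) = 0 := by
        refine S.F_zero_of (n := n - (k + 1)) ?_
        rw [← Module.End.mul_apply, ← pow_add]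
        rw [show n - (k + 1) + 1 + (k + 1) = n + 1 by omega]
        exact hn
      simp only [hG, this, mul_zero]
  have hGft : IsFT G := S.ftF k
  obtain ⟨x0, hx0⟩ := h.nonempty
  obtain ⟨η, hη, hη1⟩ := S.generic E k
  have hb := hGft.bessel hGz (η - x0)
  have hsumG : Summable (fun x : Λ => ‖G (η - x0 + x)‖ ^ 2) :=
    summable_of_sum_le (fun _ => by positivity) hb
  have hle : ∑' x : Λ, ‖G (η - x0 + x)‖ ^ 2 ≤ 1 := hsumG.tsum_le_of_sum_le hb
  have hF := h.sum (η - x0)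
  have hlt : ∑' x : Λ, ‖F (η - x0 + x)‖ ^ 2 < ∑' x : Λ, ‖G (η - x0 + x)‖ ^ 2 := by
    refine Summable.tsum_lt_tsum (i := ⟨x0, hx0⟩) ?_ ?_ hF.summable hsumG
    · intro x
      simp only [hFG]
      rw [norm_mul, mul_pow]
      have := S.m_le ((T ^ (k + 1)) (η - x0 + x))
      have h2 : ‖m ((T ^ (k + 1)) (η - x0 + x))‖ ^ 2 ≤ 1 := pow_le_one₀ (norm_nonneg _) this
      nlinarith [sq_nonneg ‖G (η - x0 + x)‖]
    · simp only [sub_add_cancel]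
      rw [hFG, norm_mul, mul_pow]
      have hG0 : G η ≠ 0 := by
        intro h0; apply hη; rw [hFG, h0, zero_mul]
      have : 0 < ‖G η‖ := norm_pos_iff.2 hG0
      have h2 : ‖m ((T ^ (k + 1)) η)‖ ^ 2 < 1 := pow_lt_one₀ (norm_nonneg _) hη1 (by norm_num)
      have h3 : 0 < ‖G η‖ ^ 2 := by positivity
      nlinarith
  rw [hF.tsum_eq] at hlt
  linarith

end

section

variable {p : ℕ} {m F : V2 → ℂ} {T : V2 →ₗ[ℝ] V2} {φ : V2 →ₗ[ℝ] ℝ} {r : ℝ} {q : ℤ} {Λ : Set V2}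

lemma IsSpec.infinite (S : Sys p m F T) (E : EigFun p m T φ r q) (h : IsSpec F Λ) :
    Λ.Infinite := by
  intro hfin
  choose x hx y hy hxy hm hu using factor S E h
  have : Finite Λ := hfin
  have hinj : Function.Injective (fun k : ℕ => ((⟨x k, hx k⟩, ⟨y k, hy k⟩) : Λ × Λ)) := by
    intro k l hkl
    simp only [Prod.mk.injEq, Subtype.mk.injEq] at hkl
    have := hm k
    rw [hkl.1, hkl.2] at this
    exact hu l k this
  exact not_injective_infinite_finite _ hinj

section val
variable (A : ValuationSubring ℝ)

lemma val_int_le (u : ℤ) : A.valuation (u : ℝ) ≤ 1 := by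
  rw [A.valuation_le_one_iff]
  exact intCast_mem A u

lemma val_int_eq (hp : p.Prime) (hA : A.valuation (p : ℝ) < 1) {u : ℤ} (hu : ¬ (p : ℤ) ∣ u) :
    A.valuation (u : ℝ) = 1 := by
  refine le_antisymm (val_int_le A u) ?_
  have hcop : IsCoprime (p : ℤ) u :=
    (Prime.coprime_iff_not_dvd (Nat.prime_iff_prime_int.1 hp)).2 hu
  obtain ⟨a, b, hab⟩ := hcop
  have h1 : A.valuation (((a : ℤ) : ℝ) * (p : ℝ) + (b : ℝ) * u) = 1 := by
    have : ((a : ℤ) : ℝ) * (p : ℝ) + (b : ℝ) * u = 1 := by exact_mod_cast hab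
    rw [this, map_one]
  by_contra hlt
  push Not at hlt
  have h2 : A.valuation (((a : ℤ) : ℝ) * (p : ℝ) + (b : ℝ) * u) < 1 := by
    refine Valuation.map_add_lt _ ?_ ?_
    · rw [map_mul]; exact mul_lt_one_of_nonneg_of_lt_one_right (val_int_le A a) zero_le hA
    · rw [map_mul]; exact mul_lt_one_of_nonneg_of_lt_one_right (val_int_le A b) zero_le hlt
  rw [h1] at h2
  exact lt_irrefl _ h2

/-- level formula -/
lemma EigFun.level (hp : p.Prime) (E : EigFun p m T φ r q) {n : ℕ} {z : V2}
    (h : m ((T ^ (n + 1)) z) = 0) :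
    ∃ u : ℤ, ¬ (p : ℤ) ∣ u ∧ p * φ z = r ^ (n + 1) * u := by
  obtain ⟨u, hu, he⟩ := E.zero _ h
  refine ⟨u, hu, ?_⟩
  rw [E.eig_pow] at he
  have hr : r ^ (n + 1) ≠ 0 := pow_ne_zero _ (by linarith [E.one_lt])
  have hp0 : (p : ℝ) ≠ 0 := by exact_mod_cast hp.ne_zero
  field_simp at he
  linarith

lemma EigFun.level_val (hp : p.Prime) (E : EigFun p m T φ r q) (hA : A.valuation (p : ℝ) < 1)
    {n : ℕ} {z : V2} (h : m ((T ^ (n + 1)) z) = 0) :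
    A.valuation (p * φ z) = A.valuation r ^ (n + 1) := by
  obtain ⟨u, hu, he⟩ := E.level hp h
  rw [he, map_mul, map_pow, val_int_eq A hp hA hu, mul_one]

lemma val_not_gt (S : Sys p m F T) (E : EigFun p m T φ r q) (h : IsSpec F Λ)
    (hA : A.valuation (p : ℝ) < 1) : ¬ 1 < A.valuation r := by
  intro hgt
  have hmono : StrictMono (fun n : ℕ => A.valuation r ^ n) := pow_right_strictMono₀ hgt
  obtain ⟨x, hx, y, hy, hxy, hxy0, -⟩ := factor S E h 0
  obtain ⟨u3, hu3, he3⟩ := E.level S.hp hxy0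
  obtain ⟨N, hN⟩ := pow_unbounded_of_one_lt (|(u3 : ℝ)|) E.one_lt
  obtain ⟨z, hz, w, hw, hzw, hzw0, -⟩ := factor S E h (N + 1)
  have hv := E.level_val A S.hp hA hzw0
  have key : ∀ z ∈ Λ, A.valuation r ^ (N + 1 + 1) ≤ A.valuation (p * φ (z - x)) → False := by
    intro z hz hle
    have hzx : z ≠ x := by
      rintro rfl
      simp only [sub_self, map_zero, mul_zero] at hle
      have : 0 < A.valuation r ^ (N + 1 + 1) := pow_pos (lt_trans zero_lt_one hgt) _
      exact absurd hle (not_le.2 this)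
    obtain ⟨n, hn⟩ := S.zero _ (h.bz z hz x hx hzx)
    rw [E.level_val A S.hp hA hn] at hle
    have hn1 : N + 1 + 1 ≤ n + 1 := hmono.le_iff_le.1 hle
    have hxyv := E.level_val A S.hp hA hxy0
    have hlt : A.valuation (p * φ (x - y)) < A.valuation (p * φ (z - x)) := by
      rw [hxyv, E.level_val A S.hp hA hn]
      exact hmono (by omega)
    have hsum : p * φ (z - y) = p * φ (x - y) + p * φ (z - x) := by
      simp only [map_sub]; ring
    have hval : A.valuation (p * φ (z - y)) = A.valuation (p * φ (z - x)) := by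
      rw [hsum]; exact Valuation.map_add_eq_of_lt_right _ hlt
    have hzy : z ≠ y := by
      rintro rfl
      simp only [sub_self, map_zero, mul_zero] at hval
      rw [← hval] at hlt
      exact absurd hlt (not_lt.2 zero_le)
    obtain ⟨n', hn'⟩ := S.zero _ (h.bz z hz y hy hzy)
    have hnn : n' = n := by
      have h1 := E.level_val A S.hp hA hn'
      rw [hval, E.level_val A S.hp hA hn] at h1
      have := hmono.injective h1
      omega
    subst hnn
    obtain ⟨u1, hu1, he1⟩ := E.level S.hp hn
    obtain ⟨u2, hu2, he2⟩ := E.level S.hp hn'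
    rw [he1, he2, he3] at hsum
    have hr0 : 0 < r := by linarith [E.one_lt]
    have h4 : r ^ n' * ((u2 - u1 : ℤ) : ℝ) = u3 := by
      push_cast
      have : r * (r ^ n' * (u2 - u1)) = r * u3 := by
        have e1 : r ^ (n' + 1) = r * r ^ n' := pow_succ' _ _
        rw [e1] at hsum
        simp only [zero_add, pow_one] at hsum
        linarith
      exact mul_left_cancel₀ hr0.ne' this
    have h5 : u2 - u1 ≠ 0 := by
      intro h0
      rw [h0] at h4
      simp at h4
      have : u3 = 0 := by exact_mod_cast h4.symm
      exact hu3 (this ▸ dvd_zero _)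
    have h6 : (1 : ℝ) ≤ |((u2 - u1 : ℤ) : ℝ)| := by
      rw [← Int.cast_abs]
      exact_mod_cast Int.one_le_abs h5
    have h7 : r ^ n' ≤ |(u3 : ℝ)| := by
      rw [← h4, abs_mul, abs_of_pos (pow_pos hr0 _)]
      nlinarith [pow_pos hr0 n']
    have h8 : r ^ N ≤ r ^ n' := pow_le_pow_right₀ E.one_lt.le (by omega)
    linarith
  have hsum : p * φ (z - w) = p * φ (z - x) - p * φ (w - x) := by
    simp only [map_sub]; ring
  have hmax := Valuation.map_sub A.valuation (p * φ (z - x)) (p * φ (w - x))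
  rw [← hsum, hv] at hmax
  rcases le_max_iff.1 hmax with h1 | h1
  · exact key z hz h1
  · exact key w hw h1

lemma val_ne_one (S : Sys p m F T) (E : EigFun p m T φ r q) (h : IsSpec F Λ)
    (hA : A.valuation (p : ℝ) < 1) (f g : Polynomial ℤ)
    (hfg : p * Polynomial.aeval r f + r * Polynomial.aeval r g = 1) : A.valuation r ≠ 1 := by
  intro h1
  have hrA : r ∈ A := (A.valuation_le_one_iff r).1 h1.le
  have hpA : (p : ℝ) ∈ A := (A.valuation_le_one_iff _).1 hA.le
  let k := IsLocalRing.ResidueField A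
  let res : A →+* k := IsLocalRing.residue A
  have hres0 : ∀ a : A, res a = 0 ↔ A.valuation (a : ℝ) < 1 := by
    intro a
    rw [← A.valuation_lt_one_iff]
    exact IsLocalRing.residue_eq_zero_iff a
  haveI : Fact p.Prime := ⟨S.hp⟩
  have hpk : (p : k) = 0 := by
    have := (hres0 (p : A)).2 (by simpa using hA)
    simpa using this
  haveI : CharP k p := by
    exact (CharP.charP_iff_prime_eq_zero S.hp).2 hpk
  letI : Algebra (ZMod p) k := ZMod.algebra k p
  let rb : k := res ⟨r, hrA⟩
  have hrel : rb * Polynomial.aeval rb (g.map (Int.castRingHom (ZMod p))) = 1 := by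
    have hA1 : (p : A) * Polynomial.aeval (⟨r, hrA⟩ : A) f + ⟨r, hrA⟩ * Polynomial.aeval (⟨r, hrA⟩ : A) g = 1 := by
      apply Subtype.ext
      have e : ∀ P : Polynomial ℤ, ((Polynomial.aeval (⟨r, hrA⟩ : A) P : A) : ℝ) = Polynomial.aeval r P := by
        intro P
        have := Polynomial.hom_eval₂ P (Int.castRingHom A) A.subtype (⟨r, hrA⟩ : A)
        simp only [Polynomial.aeval_def] 
        convert! this using 2
      push_cast
      rw [e, e]
      exact hfg
    have := congrArg res hA1
    simp only [map_add, map_mul, map_one, map_natCast, hpk, zero_mul, zero_add] at this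
    rw [← this]
    congr 1
    rw [Polynomial.aeval_def, Polynomial.aeval_def, Polynomial.eval₂_map, Polynomial.hom_eval₂]
    congr 1
    exact Subsingleton.elim _ _
  have halg : IsIntegral (ZMod p) rb := by
    have : IsAlgebraic (ZMod p) rb := by
      refine ⟨Polynomial.X * g.map (Int.castRingHom (ZMod p)) - 1, ?_, ?_⟩
      · intro h0
        have := congrArg (Polynomial.eval 0) h0
        simp at this
      · simp [hrel]
    exact this.isIntegral
  haveI : FiniteDimensional (ZMod p) (IntermediateField.adjoin (ZMod p) {rb}) :=
    IntermediateField.adjoin.finiteDimensional halg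
  haveI : Finite (IntermediateField.adjoin (ZMod p) {rb}) := Module.finite_of_finite (ZMod p)
  obtain ⟨x0, hx0⟩ := h.nonempty
  have hmem : ∀ z ∈ Λ, ∃ hz : p * φ (z - x0) ∈ A, res ⟨_, hz⟩ ∈ IntermediateField.adjoin (ZMod p) {rb} := by
    intro z hz
    by_cases hzx : z = x0
    · subst hzx
      have h0 : (p : ℝ) * φ (z - z) = 0 := by simp
      refine ⟨by rw [h0]; exact zero_mem A, ?_⟩
      have : (⟨(p : ℝ) * φ (z - z), by rw [h0]; exact zero_mem A⟩ : A) = 0 := Subtype.ext h0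
      rw [this, map_zero]
      exact zero_mem _
    · obtain ⟨n, hn⟩ := S.zero _ (h.bz z hz x0 hx0 hzx)
      obtain ⟨u, hu, he⟩ := E.level S.hp hn
      have hm : p * φ (z - x0) ∈ A := by
        rw [he]; exact mul_mem (pow_mem hrA _) (intCast_mem A u)
      refine ⟨hm, ?_⟩
      have : (⟨_, hm⟩ : A) = ⟨r, hrA⟩ ^ (n + 1) * (u : A) := by
        apply Subtype.ext
        push_cast
        exact he
      rw [this, map_mul, map_pow, map_intCast]
      refine mul_mem (pow_mem ?_ _) (intCast_mem _ u)
      exact IntermediateField.mem_adjoin_simple_self _ _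
  choose hA' hK using hmem
  let f' : Λ → IntermediateField.adjoin (ZMod p) {rb} := fun z => ⟨res ⟨_, hA' z z.2⟩, hK z z.2⟩
  have hinj : Function.Injective f' := by
    intro z w hzw
    by_contra hne
    have hne' : (z : V2) ≠ w := fun h => hne (Subtype.ext h)
    have h2 : res ⟨_, hA' z z.2⟩ = res ⟨_, hA' w w.2⟩ := congrArg Subtype.val hzw
    rw [← sub_eq_zero, ← map_sub, hres0] at h2
    obtain ⟨n, hn⟩ := S.zero _ (h.bz z z.2 w w.2 hne')
    have h3 := E.level_val A S.hp hA hn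
    rw [h1, one_pow] at h3
    have h4 : ((((⟨_, hA' z z.2⟩ : A) - ⟨_, hA' w w.2⟩ : A)) : ℝ) = p * φ (z - w) := by
      push_cast
      simp only [map_sub]; ring
    rw [h4, h3] at h2
    exact lt_irrefl _ h2
  have : Finite Λ := Finite.of_injective f' hinj
  exact (IsSpec.infinite S E h) this
end val

lemma exists_val_of (P : Subring ℝ) (I : Ideal P) (hI : I ≠ ⊤) :
    ∃ A : ValuationSubring ℝ, ∀ x ∈ I, A.valuation (x : ℝ) < 1 := by
  obtain ⟨B, -, hB⟩ := I.image_subset_nonunits_valuationSubring hI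
  exact ⟨B, fun x hx => hB ⟨x, hx, rfl⟩⟩

lemma exists_val_p (hp : p.Prime) : ∃ A : ValuationSubring ℝ, A.valuation (p : ℝ) < 1 := by
  let P := (Int.castRingHom ℝ).range
  obtain ⟨A, hA⟩ := exists_val_of P (Ideal.span {(p : P)}) (by
    intro h
    rw [Ideal.span_singleton_eq_top] at h
    obtain ⟨⟨_, n, rfl⟩, hn⟩ := h.exists_right_inv
    have h1 := congrArg Subtype.val hn
    simp only [Subring.coe_mul] at h1
    have h2 : ((p : ℤ) : ℝ) * (n : ℝ) = 1 := by simpa using h1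
    have h3 : (p : ℤ) * n = 1 := by exact_mod_cast h2
    exact (Nat.prime_iff_prime_int.1 hp).not_unit (IsUnit.of_mul_eq_one _ h3))
  refine ⟨A, ?_⟩
  simpa using hA (p : P) (Ideal.mem_span_singleton_self _)

/-- there is a `p`-adic valuation with `v(r) < 1`. -/
lemma exists_val_lt (S : Sys p m F T) (E : EigFun p m T φ r q) (h : IsSpec F Λ) :
    ∃ A : ValuationSubring ℝ, A.valuation (p : ℝ) < 1 ∧ A.valuation r < 1 := by
  let P := (Polynomial.aeval (R := ℤ) r).toRingHom.range
  have hrP : r ∈ P := ⟨Polynomial.X, by simp⟩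
  by_cases hI : Ideal.span {(p : P), ⟨r, hrP⟩} = ⊤
  · obtain ⟨A, hA⟩ := exists_val_p S.hp
    refine ⟨A, hA, ?_⟩
    rw [Ideal.eq_top_iff_one, Ideal.mem_span_pair] at hI
    obtain ⟨⟨_, f, rfl⟩, ⟨_, g, rfl⟩, hfg⟩ := hI
    have hfg' := congrArg Subtype.val hfg
    simp only [Subring.coe_mul, Subring.coe_add] at hfg'
    have h2 : (p : ℝ) * Polynomial.aeval r f + r * Polynomial.aeval r g = 1 := by
      have : Polynomial.aeval r f * (p : ℝ) + Polynomial.aeval r g * r = 1 := by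
        simpa using hfg'
      linarith
    have h3 := val_ne_one A S E h hA f g h2
    have h4 := val_not_gt A S E h hA
    exact lt_of_le_of_ne (not_lt.1 h4) h3
  · obtain ⟨A, hA⟩ := exists_val_of P _ hI
    refine ⟨A, ?_, ?_⟩
    · simpa using hA (p : P) (Ideal.subset_span (by simp))
    · exact hA ⟨r, hrP⟩ (Ideal.subset_span (by simp))

end

section

variable {p : ℕ} {m F : V2 → ℂ} {T : V2 →ₗ[ℝ] V2} {φ : V2 →ₗ[ℝ] ℝ} {r : ℝ} {q : ℤ} {Λ : Set V2}

lemma level_triple (S : Sys p m F T) (E : EigFun p m T φ r q) (h : IsSpec F Λ)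
    (A : ValuationSubring ℝ) (hA : A.valuation (p : ℝ) < 1) (hr : A.valuation r < 1)
    {x y : V2} (hx : x ∈ Λ) (hy : y ∈ Λ) {k : ℕ} (hk : m ((T ^ (k + 1 + 1)) (x - y)) = 0) :
    ∃ z ∈ Λ, m ((T ^ (0 + 1)) (x - z)) = 0 ∧ m ((T ^ (0 + 1)) (y - z)) = 0 := by
  have hr0 : 0 < A.valuation r := by
    rw [Valuation.pos_iff]; linarith [E.one_lt]
  have hanti : StrictAnti (fun n : ℕ => A.valuation r ^ n) := pow_right_strictAnti₀ hr0 hr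
  obtain ⟨P, hP, Q, hQ, hPQ, hPQ0, -⟩ := factor S E h 0
  have hvPQ := E.level_val A S.hp hA hPQ0
  -- level zero from valuation
  have lev : ∀ x ∈ Λ, ∀ z ∈ Λ, A.valuation r ≤ A.valuation (p * φ (x - z)) →
      m ((T ^ (0 + 1)) (x - z)) = 0 := by
    intro x hx z hz hle
    have hne : x ≠ z := by
      rintro rfl
      simp only [sub_self, map_zero, mul_zero] at hle
      exact absurd hle (not_le.2 hr0)
    obtain ⟨n, hn⟩ := S.zero _ (h.bz x hx z hz hne)
    rw [E.level_val A S.hp hA hn] at hle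
    have : A.valuation r ^ 1 ≤ A.valuation r ^ (n + 1) := by simpa using hle
    have h1 : n + 1 ≤ 1 := hanti.le_iff_ge.1 this
    have h2 : n = 0 := by omega
    rw [← h2]; exact hn
  obtain ⟨z, hz, hzv⟩ : ∃ z ∈ Λ, A.valuation r ≤ A.valuation (p * φ (x - z)) := by
    have hsum : p * φ (P - Q) = p * φ (x - Q) - p * φ (x - P) := by
      simp only [map_sub]; ring
    have hmax := Valuation.map_sub A.valuation (p * φ (x - Q)) (p * φ (x - P))
    rw [← hsum, hvPQ] at hmax
    rcases le_max_iff.1 hmax with h1 | h1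
    · exact ⟨Q, hQ, by simpa using h1⟩
    · exact ⟨P, hP, by simpa using h1⟩
  refine ⟨z, hz, lev x hx z hz hzv, lev y hy z hz ?_⟩
  have h0 := E.level_val A S.hp hA (lev x hx z hz hzv)
  have hlt : A.valuation (p * φ (y - x)) < A.valuation (p * φ (x - z)) := by
    have e : p * φ (y - x) = - (p * φ (x - y)) := by simp only [map_sub]; ring
    rw [e, Valuation.map_neg, E.level_val A S.hp hA hk, h0]
    exact hanti (by omega)
  have hsum : p * φ (y - z) = p * φ (y - x) + p * φ (x - z) := by
    simp only [map_sub]; ring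
  rw [hsum, Valuation.map_add_eq_of_lt_right _ hlt]
  exact hzv

lemma level_rat (S : Sys p m F T) (E : EigFun p m T φ r q) (h : IsSpec F Λ)
    {x y : V2} (hx : x ∈ Λ) (hy : y ∈ Λ) {k : ℕ} (hk : m ((T ^ (k + 1)) (x - y)) = 0) :
    ∃ u w : ℤ, ¬ (p : ℤ) ∣ u ∧ r ^ k * u = w ∧ p * φ (x - y) = r * w := by
  obtain ⟨u, hu, he⟩ := E.level S.hp hk
  cases k with
  | zero => exact ⟨u, u, hu, by simp, by simpa using he⟩
  | succ k =>
    obtain ⟨A, hA, hr⟩ := exists_val_lt S E h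
    obtain ⟨z, hz, h1, h2⟩ := level_triple S E h A hA hr hx hy hk
    obtain ⟨u1, hu1, he1⟩ := E.level S.hp h1
    obtain ⟨u2, hu2, he2⟩ := E.level S.hp h2
    have hr0 : r ≠ 0 := by linarith [E.one_lt]
    have hsum : p * φ (x - y) = p * φ (x - z) - p * φ (y - z) := by
      simp only [map_sub]; ring
    have h3 : p * φ (x - y) = r * ((u1 - u2 : ℤ) : ℝ) := by
      rw [hsum, he1, he2]; push_cast; ring
    refine ⟨u, u1 - u2, hu, ?_, h3⟩
    rw [he, pow_succ'] at h3
    apply mul_left_cancel₀ hr0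
    linarith

/-- A zero of the mask which is the image of an integer vector. -/
lemma exists_int_zero (S : Sys p m F T) (E : EigFun p m T φ r q) (h : IsSpec F Λ) :
    ∃ ω : V2, (∃ k : Fin 2 → ℤ, ∀ i, ω i = k i) ∧ m (T ω) = 0 := by
  obtain ⟨x, hx, y, hy, hxy, h1, hu⟩ := factor S E h 1
  obtain ⟨A, hA, hr⟩ := exists_val_lt S E h
  obtain ⟨z, hz, h2, h3⟩ := level_triple S E h A hA hr hx hy h1
  have hd := S.dif _ _ h2 h3
  have e : (T ^ (0 + 1)) (x - z) - (T ^ (0 + 1)) (y - z) = (T ^ (0 + 1)) (x - y) := by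
    rw [← map_sub]; congr 1; abel
  rw [e] at hd
  rcases hd with hd | hd
  · have := hu 0 hd
    omega
  · refine ⟨_, hd, ?_⟩
    convert h1 using 2
    rw [pow_succ' T 1]
    simp

lemma r_rat (S : Sys p m F T) (E : EigFun p m T φ r q) (h : IsSpec F Λ) :
    ∃ a b : ℕ, 1 ≤ a ∧ Nat.Coprime a b ∧ p ∣ b ∧ r = b / a := by
  obtain ⟨x, hx, y, hy, hxy, h1, -⟩ := factor S E h 1
  obtain ⟨u, w, hu, he, -⟩ := level_rat S E h hx hy h1
  have hu0 : (u : ℝ) ≠ 0 := by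
    intro h0
    have : u = 0 := by exact_mod_cast h0
    exact hu (this ▸ dvd_zero _)
  have hr : r = ((w / u : ℚ) : ℝ) := by
    push_cast
    rw [eq_div_iff hu0]; simpa using he
  set t : ℚ := (w / u : ℚ) with ht
  have ht0 : 0 < t := by
    have : (0 : ℝ) < (t : ℝ) := by rw [← hr]; linarith [E.one_lt]
    exact_mod_cast this
  have hnum : 0 < t.num := Rat.num_pos.2 ht0
  have hcast : (t.num.natAbs : ℤ) = t.num := Int.natAbs_of_nonneg hnum.le
  have hden : (t.den : ℝ) ≠ 0 := by exact_mod_cast t.den_nz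
  have hr2 : r = (t.num.natAbs : ℝ) / t.den := by
    have h2 : ((t.num.natAbs : ℤ) : ℝ) = (t.num : ℝ) := by rw [hcast]
    rw [Int.cast_natCast] at h2
    rw [h2, hr, Rat.cast_def]
  refine ⟨t.den, t.num.natAbs, t.pos, t.reduced.symm, ?_, hr2⟩
  obtain ⟨A, hA, hr1⟩ := exists_val_lt S E h
  by_contra hnd
  have h3 : ¬ (p : ℤ) ∣ (t.num.natAbs : ℤ) := by rwa [Int.natCast_dvd_natCast]
  have h4 := val_int_eq A S.hp hA h3
  have h5 : ((t.num.natAbs : ℤ) : ℝ) = r * ((t.den : ℤ) : ℝ) := by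
    rw [Int.cast_natCast, Int.cast_natCast, hr2]; field_simp
  rw [h5, map_mul] at h4
  have h6 := val_int_le A (t.den : ℤ)
  have h7 : A.valuation r * A.valuation ((t.den : ℤ) : ℝ) < 1 :=
    mul_lt_one_of_nonneg_of_lt_one_left zero_le hr1 h6
  rw [h4] at h7
  exact lt_irrefl _ h7

end

section

variable {p : ℕ} {m F : V2 → ℂ} {T : V2 →ₗ[ℝ] V2} {φ : V2 →ₗ[ℝ] ℝ} {r : ℝ} {q : ℤ} {Λ : Set V2}

lemma Sys.F_le (S : Sys p m F T) {θ : ℝ} (i I : ℕ) (hi : i < I) (η : V2)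
    (h : ‖m ((T ^ (i + 1)) η)‖ ≤ θ) : ‖F η‖ ≤ θ * ‖F ((T ^ I) η)‖ := by
  rw [S.F_eq I, norm_mul, norm_prod]
  refine mul_le_mul_of_nonneg_right ?_ (norm_nonneg _)
  rw [← Finset.mul_prod_erase _ _ (Finset.mem_range.2 hi)]
  have h1 : ∏ x ∈ (Finset.range I).erase i, ‖m ((T ^ (x + 1)) η)‖ ≤ 1 :=
    Finset.prod_le_one (fun _ _ => norm_nonneg _) (fun _ _ => S.m_le _)
  have h2 := norm_nonneg (m ((T ^ (i + 1)) η))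
  calc _ ≤ ‖m ((T ^ (i + 1)) η)‖ * 1 := mul_le_mul_of_nonneg_left h1 h2
    _ ≤ θ := by linarith

/-- near integers in a row force divisibility -/
lemma chain_dvd {a b : ℕ} (ha : 2 ≤ a) (hb : 2 ≤ b) (hab : Nat.Coprime a b) (hr1 : (1 : ℝ) ≤ b / a) (n : ℕ)
    (Y ε : ℝ) (hε : ε = 1 / (2 * ((a : ℝ) + b)))
    (N : ℕ → ℤ) (hN : ∀ i < n + 2, |Y / ((b : ℝ) / a) ^ (i + 1) - N i| < ε)
    (hY1 : (b : ℝ) ≤ |Y|) (hY2 : |Y| + 1 < (b : ℝ) ^ (n + 1)) : False := by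
  have ha0 : (0 : ℝ) < a := by positivity
  have hb0 : (0 : ℝ) < b := by positivity
  have ha2 : (2 : ℝ) ≤ a := by exact_mod_cast ha
  have hb2 : (2 : ℝ) ≤ b := by exact_mod_cast hb
  have hε0 : 0 < ε := by rw [hε]; positivity
  have hε1 : ε * (a + b) < 1 := by
    rw [hε]; field_simp; norm_num
  have hrec : ∀ i < n + 1, (a : ℤ) * N i = b * N (i + 1) := by
    intro i hi
    have h1 := hN i (by omega)
    have h2 := hN (i + 1) (by omega)
    have e : (a : ℝ) * (Y / ((b : ℝ) / a) ^ (i + 1)) = b * (Y / ((b : ℝ) / a) ^ (i + 1 + 1)) := by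
      rw [pow_succ _ (i + 1)]; field_simp
    set X := Y / ((b : ℝ) / a) ^ (i + 1)
    set X' := Y / ((b : ℝ) / a) ^ (i + 1 + 1)
    rw [abs_lt] at h1 h2
    have h3 : |((a * N i - b * N (i + 1) : ℤ) : ℝ)| < 1 := by
      push_cast
      rw [abs_lt]
      constructor <;> nlinarith
    have h4 : |(a * N i - b * N (i + 1) : ℤ)| < 1 := by
      rw [← Int.cast_abs] at h3
      exact_mod_cast h3
    have h5 := Int.abs_lt_one_iff.1 h4
    linarith
  have hpow : ∀ i ≤ n + 1, (a : ℤ) ^ i * N 0 = b ^ i * N i := by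
    intro i
    induction i with
    | zero => intro _; simp
    | succ i ih =>
      intro hi
      have h1 := ih (by omega)
      have h2 := hrec i (by omega)
      calc (a : ℤ) ^ (i + 1) * N 0 = a * (a ^ i * N 0) := by ring
        _ = b ^ i * (a * N i) := by rw [h1]; ring
        _ = b ^ (i + 1) * N (i + 1) := by rw [h2]; ring
  have hd : (b : ℤ) ^ (n + 1) ∣ N 0 := by
    have h1 : (b : ℤ) ^ (n + 1) ∣ (a : ℤ) ^ (n + 1) * N 0 := ⟨_, hpow (n + 1) le_rfl⟩
    have hc : IsCoprime ((b : ℤ) ^ (n + 1)) ((a : ℤ) ^ (n + 1)) := by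
      apply IsCoprime.pow
      exact (Nat.isCoprime_iff_coprime.2 hab).symm
    exact hc.dvd_of_dvd_mul_left h1
  have h0 := hN 0 (by omega)
  simp only [zero_add, pow_one] at h0
  have e : Y / ((b : ℝ) / a) = Y * a / b := by field_simp
  have hhalf : ε < 1 := by nlinarith
  by_cases hN0 : N 0 = 0
  · rw [hN0] at h0
    simp only [Int.cast_zero, sub_zero] at h0
    rw [abs_div, abs_of_pos (by positivity : (0 : ℝ) < b / a), div_lt_iff₀ (by positivity)] at h0
    have : (b : ℝ) / a ≤ b := by rw [div_le_iff₀ ha0]; nlinarith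
    have : ε * ((b : ℝ) / a) < 1 * b := by
      apply mul_lt_mul' hhalf.le ?_ (by positivity) one_pos |>.trans_le' le_rfl
      rw [div_lt_iff₀ ha0]; nlinarith
    linarith
  · have h1 : (b : ℤ) ^ (n + 1) ≤ |N 0| := Int.le_of_dvd (abs_pos.2 hN0) ((dvd_abs _ _).2 hd)
    have h2 : (b : ℝ) ^ (n + 1) ≤ |(N 0 : ℝ)| := by
      rw [← Int.cast_abs]; exact_mod_cast h1
    have h3 : |(N 0 : ℝ)| ≤ |Y / ((b : ℝ) / a)| + ε := by
      have := abs_sub_abs_le_abs_sub (N 0 : ℝ) (Y / ((b : ℝ) / a))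
      rw [abs_sub_comm] at this
      linarith
    have h4 : |Y / ((b : ℝ) / a)| ≤ |Y| := by
      rw [abs_div, abs_of_pos (by positivity : (0 : ℝ) < b / a)]
      exact div_le_self (abs_nonneg _) hr1
    linarith

lemma step_decay (S : Sys p m F T) (E : EigFun p m T φ r q) {a b : ℕ} (ha : 2 ≤ a) (hb : 2 ≤ b)
    (hab : Nat.Coprime a b) (hr : r = b / a) :
    ∃ θ : ℝ, 0 ≤ θ ∧ θ < 1 ∧ ∃ Y0 : ℝ, ∀ η, Y0 ≤ |q * φ η| →
      ∃ η', ‖F η‖ ≤ θ * ‖F η'‖ ∧ |q * φ η| ≤ |q * φ η'| ^ (2 * b) := by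
  have ha0 : (0 : ℝ) < a := by positivity
  have hb0 : (0 : ℝ) < b := by positivity
  have ha2 : (2 : ℝ) ≤ a := by exact_mod_cast ha
  have hb2 : (2 : ℝ) ≤ b := by exact_mod_cast hb
  obtain ⟨θ, hθ0, hθ1, hθ⟩ := E.near (1 / (2 * ((a : ℝ) + b))) (by positivity)
  refine ⟨θ, hθ0, hθ1, (b : ℝ) ^ (4 * b ^ 4 + 1), fun η hη => ?_⟩
  set Y := (q : ℝ) * φ η with hY
  have hbY : (b : ℝ) ≤ |Y| := by
    refine le_trans ?_ hη
    calc (b : ℝ) = b ^ 1 := by ring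
      _ ≤ _ := pow_le_pow_right₀ (by linarith) (by omega)
  obtain ⟨n, hn1, hn2⟩ := exists_nat_pow_near (x := |Y| + 1) (y := (b : ℝ))
    (by linarith [abs_nonneg Y]) (by linarith)
  have hnbig : 4 * b ^ 4 ≤ n := by
    have : (b : ℝ) ^ (4 * b ^ 4 + 1) < b ^ (n + 1) := by linarith
    have := (pow_lt_pow_iff_right₀ (by linarith : (1 : ℝ) < b)).1 this
    omega
  have hψ : ∀ i, (q : ℝ) * φ ((T ^ i) η) = Y / ((b : ℝ) / a) ^ i := by
    intro i
    rw [E.eig_pow, hr, hY]; ring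
  refine ⟨(T ^ (n + 2)) η, ?_, ?_⟩
  · by_cases hex : ∃ i < n + 2, ∀ N : ℤ, 1 / (2 * ((a : ℝ) + b)) ≤ |Y / ((b : ℝ) / a) ^ (i + 1) - N|
    · obtain ⟨i, hi, hiN⟩ := hex
      refine S.F_le i (n + 2) hi η (hθ _ ?_)
      intro N
      rw [hψ]; exact hiN N
    · exfalso
      push Not at hex
      choose! N hN using hex
      refine chain_dvd ha hb hab ?_ n Y _ rfl N hN hbY hn2
      rw [← hr]; exact E.one_lt.le
  · rw [hψ, pow_mul]
    have h1 : |Y| ≤ (b : ℝ) ^ (n + 1) := by linarith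
    have hba : (b : ℝ) ≤ a ^ b := by
      have h2 : b ≤ 2 ^ b := Nat.lt_two_pow_self.le
      calc (b : ℝ) ≤ 2 ^ b := by exact_mod_cast h2
        _ ≤ a ^ b := by gcongr
    have h2 : (b : ℝ) ^ (n + 1) ≤ ((a : ℝ) ^ (n + 1)) ^ b := by
      calc (b : ℝ) ^ (n + 1) ≤ (a ^ b) ^ (n + 1) := by gcongr
        _ = _ := by rw [← pow_mul, ← pow_mul, mul_comm]
    refine h1.trans (h2.trans ?_)
    refine pow_le_pow_left₀ (by positivity) ?_ b
    rw [sq_abs, div_pow Y, div_pow (b : ℝ) (a : ℝ), div_pow _ _ 2]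
    have hY3 : (b : ℝ) ^ n / 2 ≤ |Y| := by linarith
    have hY4 : ((b : ℝ) ^ n / 2) ^ 2 ≤ Y ^ 2 := by
      rw [← sq_abs Y]; gcongr
    have hn4 : (4 : ℝ) * b ^ 4 ≤ a ^ n := by
      have h3 : 4 * b ^ 4 ≤ 2 ^ n := hnbig.trans Nat.lt_two_pow_self.le
      calc (4 : ℝ) * b ^ 4 ≤ 2 ^ n := by exact_mod_cast h3
        _ ≤ a ^ n := by gcongr
    rw [le_div_iff₀ (by positivity)]
    refine le_trans ?_ hY4
    have e1 : ((b : ℝ) ^ (n + 2) / a ^ (n + 2)) ^ 2 = (b ^ n) ^ 2 * b ^ 4 / ((a ^ (n + 1)) * (a ^ n * a ^ 3)) := by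
      rw [div_pow]; congr 1 <;> ring
    rw [← div_pow, e1]
    have hb4 : (b : ℝ) ^ 4 * 4 ≤ a ^ n * a ^ 3 := by
      have : (1 : ℝ) ≤ a ^ 3 := one_le_pow₀ (by linarith)
      nlinarith [pow_pos ha0 n]
    rw [mul_div_assoc', div_le_iff₀ (by positivity)]
    have := mul_le_mul_of_nonneg_left hb4 (by positivity : (0 : ℝ) ≤ a ^ (n + 1) * (b ^ n) ^ 2)
    nlinarith

lemma decay (S : Sys p m F T) (E : EigFun p m T φ r q) {a b : ℕ} (ha : 2 ≤ a) (hb : 2 ≤ b)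
    (hab : Nat.Coprime a b) (hr : r = b / a) :
    ∃ θ : ℝ, 0 ≤ θ ∧ θ < 1 ∧ ∃ s : ℕ, ∀ j η, (a : ℝ) ^ ((2 * b) ^ (s + j)) ≤ |q * φ η| →
      ‖F η‖ ≤ θ ^ j := by
  obtain ⟨θ, hθ0, hθ1, Y0, hY⟩ := step_decay S E ha hb hab hr
  have ha2 : (2 : ℝ) ≤ a := by exact_mod_cast ha
  obtain ⟨s, hs⟩ := pow_unbounded_of_one_lt Y0 (by linarith : (1 : ℝ) < a)
  refine ⟨θ, hθ0, hθ1, s, fun j => ?_⟩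
  have hs2 : ∀ j, Y0 ≤ (a : ℝ) ^ ((2 * b) ^ (s + j)) := by
    intro j
    refine hs.le.trans (pow_le_pow_right₀ (by linarith) ?_)
    calc s ≤ s + j := by omega
      _ ≤ (2 * b) ^ (s + j) := (Nat.lt_pow_self (by omega)).le
  induction j with
  | zero => intro η _; simpa using S.ftF0.norm_le η
  | succ j ih =>
    intro η hη
    obtain ⟨η', h1, h2⟩ := hY η ((hs2 _).trans hη)
    have h3 : ((a : ℝ) ^ ((2 * b) ^ (s + j))) ^ (2 * b) ≤ |q * φ η'| ^ (2 * b) := by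
      refine le_trans (le_of_eq ?_) (hη.trans h2)
      rw [← pow_mul, ← pow_succ]; rfl
    have h4 := le_of_pow_le_pow_left₀ (by omega) (abs_nonneg _) h3
    calc ‖F η‖ ≤ θ * ‖F η'‖ := h1
      _ ≤ θ * θ ^ j := mul_le_mul_of_nonneg_left (ih η' h4) hθ0
      _ = θ ^ (j + 1) := by ring

end

section

variable {p : ℕ} {m F : V2 → ℂ} {T : V2 →ₗ[ℝ] V2} {φ : V2 →ₗ[ℝ] ℝ} {r : ℝ} {q : ℤ} {Λ : Set V2}

lemma IsFT.bessel' {f : V2 → ℂ} (hf : IsFT f) (s : Finset V2)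
    (hs : ∀ x ∈ s, ∀ y ∈ s, x ≠ y → f (x - y) = 0) (ξ : V2) :
    ∑ x ∈ s, ‖f (ξ + x)‖ ^ 2 ≤ 1 := by
  have := hf.bessel (Λ := (s : Set V2)) (fun x hx y hy => hs x hx y hy) ξ Finset.univ
  exact (Finset.sum_coe_sort s (fun x => ‖f (ξ + x)‖ ^ 2)).symm.le.trans this

lemma level_sep (S : Sys p m F T) (E : EigFun p m T φ r q) (h : IsSpec F Λ)
    {a b : ℕ} (ha : 2 ≤ a) (hb : 2 ≤ b) (hab : Nat.Coprime a b) (hr : r = b / a)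
    {x y : V2} (hx : x ∈ Λ) (hy : y ∈ Λ) {k : ℕ} (hk : m ((T ^ (k + 1)) (x - y)) = 0) :
    r * b ^ k ≤ p * |φ (x - y)| := by
  obtain ⟨u, w, hu, h1, h2⟩ := level_rat S E h hx hy hk
  have ha0 : (0 : ℝ) < a := by positivity
  have hb0 : (0 : ℝ) < b := by positivity
  have hr0 : 0 < r := by rw [hr]; positivity
  have hu0 : u ≠ 0 := by rintro rfl; exact hu (dvd_zero _)
  have hw0 : w ≠ 0 := by
    rintro rfl
    simp only [Int.cast_zero, mul_eq_zero, Int.cast_eq_zero] at h1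
    rcases h1 with h1 | h1
    · exact (pow_pos hr0 k).ne' h1
    · exact hu0 h1
  have h3 : (b : ℤ) ^ k * u = a ^ k * w := by
    have : (b : ℝ) ^ k * u = a ^ k * w := by
      rw [← h1, hr, div_pow]; field_simp
    exact_mod_cast this
  have h4 : (b : ℤ) ^ k ∣ w := by
    have hc : IsCoprime ((b : ℤ) ^ k) ((a : ℤ) ^ k) :=
      IsCoprime.pow (Nat.isCoprime_iff_coprime.2 hab).symm
    exact hc.dvd_of_dvd_mul_left ⟨u, h3.symm⟩
  have h5 : (b : ℤ) ^ k ≤ |w| := Int.le_of_dvd (abs_pos.2 hw0) ((dvd_abs _ _).2 h4)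
  have h6 : (b : ℝ) ^ k ≤ |(w : ℝ)| := by rw [← Int.cast_abs]; exact_mod_cast h5
  have h7 : (p : ℝ) * |φ (x - y)| = r * |(w : ℝ)| := by
    have := congrArg abs h2
    rwa [abs_mul, abs_mul, abs_of_pos hr0, abs_of_nonneg (Nat.cast_nonneg p)] at this
  rw [h7]
  exact mul_le_mul_of_nonneg_left h6 hr0.le

open Classical in
/-- mass of the truncated spectrum -/
def Nk (F : V2 → ℂ) (φ : V2 →ₗ[ℝ] ℝ) (Λ : Set V2) (ξ : V2) (C : ℝ) : ℝ :=
  ∑' x : Λ, if |φ (ξ + x)| < C then ‖F (ξ + x)‖ ^ 2 else 0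

open Classical in
lemma Nk_summable (h : IsSpec F Λ) (ξ : V2) (C : ℝ) :
    Summable (fun x : Λ => if |φ (ξ + x)| < C then ‖F (ξ + x)‖ ^ 2 else 0) := by
  refine Summable.of_nonneg_of_le (fun x => ?_) (fun x => ?_) (h.sum ξ).summable
  · split_ifs <;> positivity
  · split_ifs
    · exact le_rfl
    · positivity

open Classical in
lemma Nk_step (S : Sys p m F T) (E : EigFun p m T φ r q) (h : IsSpec F Λ)
    {a b : ℕ} (ha : 2 ≤ a) (hb : 2 ≤ b) (hab : Nat.Coprime a b) (hr : r = b / a)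
    (ξ : V2) (k k' : ℕ) (hkk : k ≤ k') (ε : ℝ) (hε : 0 ≤ ε)
    (hF : ∀ η, r * b ^ k / (2 * p) ≤ |φ η| → ‖F ((T ^ k') η)‖ ^ 2 ≤ ε) :
    (1 - ε) * (1 - Nk F φ Λ ξ (r * b ^ k / (2 * p))) ≤ 1 - Nk F φ Λ ξ (r * b ^ k' / (2 * p)) := by
  have hp0 : (0 : ℝ) < p := by exact_mod_cast S.hp.pos
  have hb2 : (2 : ℝ) ≤ b := by exact_mod_cast hb
  have hr0 : 0 < r := by linarith [E.one_lt]
  set C := r * b ^ k / (2 * p) with hC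
  set C' := r * b ^ k' / (2 * p) with hC'
  have hCC : C ≤ C' := by
    rw [hC, hC']
    gcongr
    linarith
  set G : V2 → ℂ := fun η => ∏ i ∈ Finset.range k', m ((T ^ (i + 1)) η) with hG
  set H : Λ → ℝ := fun x => if |φ (ξ + x)| < C' then ‖G (ξ + x)‖ ^ 2 else 0 with hH
  have hH0 : ∀ x, 0 ≤ H x := by
    intro x; simp only [hH]; split_ifs <;> positivity
  have hHle : ∀ s : Finset Λ, ∑ x ∈ s, H x ≤ 1 := by
    intro s
    have hb' := (S.ftm k').bessel' ((s.filter (fun x : Λ => |φ (ξ + (x : V2))| < C')).map (Function.Embedding.subtype (· ∈ Λ)))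
      (by
        intro x hx y hy hxy
        simp only [Finset.mem_map, Finset.mem_filter, Function.Embedding.subtype_apply] at hx hy
        obtain ⟨x', ⟨_, hx2⟩, rfl⟩ := hx
        obtain ⟨y', ⟨_, hy2⟩, rfl⟩ := hy
        obtain ⟨n, hn⟩ := S.zero _ (h.bz _ x'.2 _ y'.2 hxy)
        have h1 := level_sep S E h ha hb hab hr x'.2 y'.2 hn
        have h2 : |φ ((x' : V2) - y')| < 2 * C' := by
          have e : φ ((x' : V2) - y') = φ (ξ + x') - φ (ξ + y') := by simp only [map_sub, map_add]; ring
          rw [e]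
          have := abs_sub (φ (ξ + x')) (φ (ξ + y'))
          linarith
        have h3 : r * b ^ n < r * b ^ k' := by
          have : (p : ℝ) * |φ ((x' : V2) - y')| < p * (2 * C') := mul_lt_mul_of_pos_left h2 hp0
          have e : (p : ℝ) * (2 * C') = r * b ^ k' := by rw [hC']; field_simp
          linarith
        have h4 : n < k' :=
          (pow_lt_pow_iff_right₀ (by linarith : (1 : ℝ) < b)).1 (lt_of_mul_lt_mul_left h3 hr0.le)
        exact Finset.prod_eq_zero (Finset.mem_range.2 h4) hn) ξ
    rw [Finset.sum_map, Finset.sum_filter] at hb'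
    exact hb'
  have hHs : Summable H := summable_of_sum_le hH0 hHle
  have hH1 : ∑' x, H x ≤ 1 := hHs.tsum_le_of_sum_le hHle
  have hN := Nk_summable (φ := φ) h ξ C
  have hN' := Nk_summable (φ := φ) h ξ C'
  have hle : ∀ x : Λ, (if |φ (ξ + x)| < C' then ‖F (ξ + x)‖ ^ 2 else 0)
      ≤ ε * H x + (1 - ε) * (if |φ (ξ + x)| < C then ‖F (ξ + x)‖ ^ 2 else 0) := by
    intro x
    have e : ‖F (ξ + x)‖ ^ 2 = ‖G (ξ + x)‖ ^ 2 * ‖F ((T ^ k') (ξ + x))‖ ^ 2 := by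
      rw [S.F_eq k', norm_mul, mul_pow]
    have hF1 : ‖F ((T ^ k') (ξ + x))‖ ^ 2 ≤ 1 :=
      pow_le_one₀ (norm_nonneg _) (S.ftF0.norm_le _)
    have hG0 : 0 ≤ ‖G (ξ + x)‖ ^ 2 := by positivity
    by_cases h1 : |φ (ξ + x)| < C
    · have h2 : |φ (ξ + x)| < C' := h1.trans_le hCC
      simp only [hH, h1, h2, if_true]
      have : ‖F (ξ + x)‖ ^ 2 ≤ ‖G (ξ + x)‖ ^ 2 := by rw [e]; nlinarith
      nlinarith
    · by_cases h2 : |φ (ξ + x)| < C'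
      · simp only [hH, h1, h2, if_true, if_false]
        have := hF (ξ + x) (not_lt.1 h1)
        rw [e]; nlinarith
      · simp only [hH, h1, h2, if_false]; simp
  have hfin := hN'.tsum_le_tsum hle ((hHs.mul_left ε).add (hN.mul_left (1 - ε)))
  rw [(hHs.mul_left ε).tsum_add (hN.mul_left (1 - ε)), tsum_mul_left, tsum_mul_left] at hfin
  change Nk F φ Λ ξ C' ≤ ε * (∑' x, H x) + (1 - ε) * Nk F φ Λ ξ C at hfin
  nlinarith

lemma exists_good (S : Sys p m F T) (hΛ : Λ.Countable) : ∃ ξ, ∀ x ∈ Λ, F (ξ + x) ≠ 0 := by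
  have hc : (⋃ x ∈ Λ, (fun ξ => ξ + x) ⁻¹' {ξ | F ξ = 0}).Countable := by
    refine hΛ.biUnion fun x _ => ?_
    exact S.F_cnt.preimage_of_injOn (add_left_injective x).injOn
  by_contra hcon
  push Not at hcon
  have hu : (Set.univ : Set V2).Countable := by
    refine hc.mono ?_
    intro ξ _
    obtain ⟨x, hx, h0⟩ := hcon ξ
    exact Set.mem_biUnion hx h0
  have h2 : (Set.univ : Set ℝ).Countable := by
    have := hu.preimage_of_injOn (f := fun t : ℝ => (fun _ => t : V2))
      (fun s _ t _ hst => congrFun hst 0)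
    simpa using this
  exact Cardinal.not_countable_real h2

open Classical in
lemma Nk_lt_one (S : Sys p m F T) (E : EigFun p m T φ r q) (h : IsSpec F Λ)
    {a b : ℕ} (ha : 2 ≤ a) (hb : 2 ≤ b) (hab : Nat.Coprime a b) (hr : r = b / a)
    (ξ : V2) (hξ : ∀ x ∈ Λ, F (ξ + x) ≠ 0) (k : ℕ) : Nk F φ Λ ξ (r * b ^ k / (2 * p)) < 1 := by
  have hp0 : (0 : ℝ) < p := by exact_mod_cast S.hp.pos
  set C := r * b ^ k / (2 * p) with hC
  obtain ⟨z, hz⟩ : ∃ z : Λ, ¬ |φ (ξ + z)| < C := by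
    obtain ⟨x, hx, y, hy, hxy, h0, -⟩ := factor S E h k
    by_contra hcon
    push Not at hcon
    have h1 := hcon ⟨x, hx⟩
    have h2 := hcon ⟨y, hy⟩
    have h3 := level_sep S E h ha hb hab hr hx hy h0
    have e : φ (x - y) = φ (ξ + x) - φ (ξ + y) := by simp only [map_sub, map_add]; ring
    have h4 : |φ (x - y)| < 2 * C := by
      rw [e]
      have := abs_sub (φ (ξ + x)) (φ (ξ + y))
      simp only at h1 h2
      linarith
    have : (p : ℝ) * |φ (x - y)| < p * (2 * C) := mul_lt_mul_of_pos_left h4 hp0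
    have e : (p : ℝ) * (2 * C) = r * b ^ k := by rw [hC]; field_simp
    linarith
  have hlt := Summable.tsum_lt_tsum (i := z)
    (f := fun x : Λ => if |φ (ξ + x)| < C then ‖F (ξ + x)‖ ^ 2 else 0)
    (g := fun x : Λ => ‖F (ξ + x)‖ ^ 2) (fun x => by
      show (if _ then _ else _) ≤ _
      split_ifs
      · exact le_rfl
      · positivity)
    (by
      show (if _ then _ else _) < _
      rw [if_neg hz]
      have := norm_pos_iff.2 (hξ z z.2)
      positivity) (Nk_summable h ξ C) (h.sum ξ).summable
  rw [(h.sum ξ).tsum_eq] at hlt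
  exact hlt

open Classical in
lemma Nk_tendsto (h : IsSpec F Λ) (ξ : V2) (d : ℝ) (hd : 0 < d) :
    ∃ C0, ∀ C, C0 ≤ C → 1 - d < Nk F φ Λ ξ C := by
  have h1 := (h.sum ξ).eventually (lt_mem_nhds (show 1 - d < 1 by linarith))
  obtain ⟨s, hs⟩ := h1.exists
  refine ⟨∑ x ∈ s, |φ (ξ + x)| + 1, fun C hC => ?_⟩
  refine lt_of_lt_of_le hs ?_
  refine le_trans (le_of_eq ?_) ((Nk_summable (φ := φ) h ξ C).sum_le_tsum s (fun x _ => by split_ifs <;> positivity))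
  refine Finset.sum_congr rfl fun x hx => ?_
  rw [if_pos]
  have := Finset.single_le_sum (f := fun x : Λ => |φ (ξ + x)|) (fun x _ => abs_nonneg _) hx
  linarith

end

section

variable {p : ℕ} {m F : V2 → ℂ} {T : V2 →ₗ[ℝ] V2} {φ : V2 →ₗ[ℝ] ℝ} {r : ℝ} {q : ℤ} {Λ : Set V2}

lemma no_decay (D e : ℕ → ℝ) (hD : ∀ j, 0 < D j) (he : ∀ j, 0 ≤ e j) (hs : Summable e)
    (h : ∀ j, (1 - e j) * D j ≤ D (j + 1)) : ∃ d, 0 < d ∧ ∃ J, ∀ j, J ≤ j → d ≤ D j := by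
  have h1 := tendsto_sum_nat_add e
  obtain ⟨J, hJ⟩ := (h1.eventually (gt_mem_nhds (show (0 : ℝ) < 1 / 2 by norm_num))).exists
  have hsJ : Summable (fun i => e (i + J)) := (summable_nat_add_iff J).2 hs
  have hpart : ∀ n, ∑ i ∈ Finset.range n, e (i + J) ≤ 1 / 2 := fun n =>
    (hsJ.sum_le_tsum _ (fun i _ => he _)).trans hJ.le
  have hind : ∀ n, (1 - ∑ i ∈ Finset.range n, e (i + J)) * D J ≤ D (n + J) := by
    intro n
    induction n with
    | zero => simp
    | succ n ih =>
      have h2 := h (n + J)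
      have h3 := hpart (n + 1)
      have h4 := hpart n
      rw [Finset.sum_range_succ] at h3 ⊢
      have h5 : 0 ≤ ∑ i ∈ Finset.range n, e (i + J) := Finset.sum_nonneg fun i _ => he _
      have h6 := he (n + J)
      have e1 : n + 1 + J = n + J + 1 := by ring
      rw [e1]
      refine le_trans ?_ h2
      refine le_trans ?_ (mul_le_mul_of_nonneg_left ih (by linarith))
      have := hD J
      nlinarith [mul_nonneg (mul_nonneg h5 h6) this.le]
  refine ⟨D J / 2, by linarith [hD J], J, fun j hj => ?_⟩
  have h7 := hind (j - J)
  rw [Nat.sub_add_cancel hj] at h7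
  have := hpart (j - J)
  nlinarith [hD J]

lemma dai (S : Sys p m F T) (E : EigFun p m T φ r q) (h : IsSpec F Λ) (hΛ : Λ.Countable)
    {a b : ℕ} (ha : 2 ≤ a) (hb : 2 ≤ b) (hab : Nat.Coprime a b) (hr : r = b / a) : False := by
  have hp0 : (0 : ℝ) < p := by exact_mod_cast S.hp.pos
  have ha2 : (2 : ℝ) ≤ a := by exact_mod_cast ha
  have hb2 : (2 : ℝ) ≤ b := by exact_mod_cast hb
  have ha0 : (0 : ℝ) < a := by linarith
  have hb0 : (0 : ℝ) < b := by linarith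
  have hr1 := E.one_lt
  obtain ⟨ξ, hξ⟩ := exists_good S hΛ
  obtain ⟨θ, hθ0, hθ1, s, hdec⟩ := decay S E ha hb hab hr
  set H := 2 * b with hH
  have hH2 : 2 ≤ H := by omega
  have hba : (b : ℝ) ≤ a ^ b := by
    have h2 : b ≤ 2 ^ b := Nat.lt_two_pow_self.le
    calc (b : ℝ) ≤ 2 ^ b := by exact_mod_cast h2
      _ ≤ a ^ b := by gcongr
  let N : ℕ → ℝ := fun k => Nk F φ Λ ξ (r * b ^ k / (2 * p))
  have hN1 : ∀ k, N k < 1 := fun k => Nk_lt_one S E h ha hb hab hr ξ hξ k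
  let L : ℕ := H ^ 2 - H
  have hL : H + L = H ^ 2 := by
    have : H ≤ H ^ 2 := by nlinarith
    omega
  -- one block
  have hblock : ∀ j, (1 - L * θ ^ j) * (1 - N (H ^ (s + 2 * p + j + 1))) ≤ 1 - N (H ^ (s + 2 * p + (j + 1) + 1)) := by
    intro j
    set n := s + 2 * p + j with hn
    set t := H ^ n with ht
    have ht2p : 2 * p ≤ t := by
      calc 2 * p ≤ n := by omega
        _ ≤ t := (Nat.lt_pow_self (by omega)).le
    set ε := (θ ^ (2 * p + j)) ^ 2 with hε
    have hε0 : 0 ≤ ε := by positivity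
    have hε1 : ε ≤ θ ^ j := by
      rw [hε, ← pow_mul]
      exact pow_le_pow_of_le_one hθ0 hθ1.le (by omega)
    have hε2 : ε ≤ 1 := hε1.trans (pow_le_one₀ hθ0 hθ1.le)
    have hstep : ∀ i, (1 - ε) * (1 - N (H ^ (n + 1) + i * t)) ≤ 1 - N (H ^ (n + 1) + (i + 1) * t) := by
      intro i
      refine Nk_step S E h ha hb hab hr ξ _ _ (by nlinarith) ε hε0 ?_
      intro η hη
      have hk : H ^ (n + 1) + (i + 1) * t = (H ^ (n + 1) + i * t) + t := by ring
      set k := H ^ (n + 1) + i * t with hkdef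
      have hkt : b * t + b * t ≤ k := by
        have : H ^ (n + 1) = b * t + b * t := by rw [pow_succ, hH]; ring
        rw [hkdef, this]; exact Nat.le_add_right _ _
      rw [hk]
      clear_value k
      have hb1 : ‖F ((T ^ (k + t)) η)‖ ≤ θ ^ (2 * p + j) := by
        apply hdec
        have e0 : s + (2 * p + j) = n := by rw [hn]; ring
        rw [e0, ← ht, E.eig_pow]
        have hq1 : (1 : ℝ) ≤ |(q : ℝ)| := by
          rw [← Int.cast_abs]; exact_mod_cast Int.one_le_abs E.q0
        rw [abs_mul, abs_div, abs_of_pos (by positivity : 0 < r ^ (k + t))]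
        have h1 : r * b ^ k / (2 * p) / r ^ (k + t) ≤ |φ η| / r ^ (k + t) := by gcongr
        have h2 : (a : ℝ) ^ t ≤ r * b ^ k / (2 * p) / r ^ (k + t) := by
          have h3 : (b : ℝ) ^ k / r ^ (k + t) = a ^ (k + t) / b ^ t := by
            rw [hr, div_pow, pow_add (b : ℝ) k t]; field_simp
          have h4 : r * b ^ k / (2 * p) / r ^ (k + t) = r * ((a : ℝ) ^ (k + t) / b ^ t) / (2 * p) := by
            rw [← h3]; ring
          rw [h4, le_div_iff₀ (by positivity)]
          have h5 : (b : ℝ) ^ t ≤ a ^ (b * t) := by rw [pow_mul]; gcongr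
          have h6 : (a : ℝ) ^ t * a ^ (b * t) * a ^ (b * t) ≤ a ^ (k + t) := by
            rw [← pow_add, ← pow_add]
            exact pow_le_pow_right₀ (by linarith) (by omega)
          have h7 : (2 * p : ℝ) ≤ a ^ (b * t) := by
            have h8 : 2 * p ≤ 2 ^ (b * t) := by
              calc 2 * p ≤ t := ht2p
                _ ≤ b * t := by nlinarith
                _ ≤ _ := Nat.lt_two_pow_self.le
            calc (2 * p : ℝ) ≤ 2 ^ (b * t) := by exact_mod_cast h8
              _ ≤ _ := by gcongr
          have h9 : (a : ℝ) ^ t * (2 * p) ≤ a ^ (k + t) / b ^ t := by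
            rw [le_div_iff₀ (by positivity)]
            refine le_trans ?_ h6
            gcongr
          have h10 : 0 ≤ (a : ℝ) ^ (k + t) / b ^ t := by positivity
          nlinarith
        have h3 : 0 ≤ |φ η| / r ^ (k + t) := by positivity
        nlinarith
      rw [hε]
      exact pow_le_pow_left₀ (norm_nonneg _) hb1 2
    have hind : ∀ i, (1 - ε) ^ i * (1 - N (H ^ (n + 1))) ≤ 1 - N (H ^ (n + 1) + i * t) := by
      intro i
      induction i with
      | zero => simp
      | succ i ih =>
        refine le_trans ?_ (hstep i)
        have := mul_le_mul_of_nonneg_left ih (by linarith : 0 ≤ 1 - ε)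
        refine le_trans (le_of_eq ?_) this
        ring
    have h1 := hind L
    have e1 : H ^ (n + 1) + L * t = H ^ (s + 2 * p + (j + 1) + 1) := by
      have : s + 2 * p + (j + 1) + 1 = n + 2 := by omega
      rw [this, ht]
      calc H ^ (n + 1) + L * H ^ n = H ^ n * (H + L) := by ring
        _ = H ^ (n + 2) := by rw [hL]; ring
    rw [e1] at h1
    refine le_trans ?_ h1
    refine mul_le_mul_of_nonneg_right ?_ (by linarith [hN1 (H ^ (n + 1))])
    have hbern := one_add_mul_le_pow (a := -ε) (by linarith) L
    have e2 : 1 + -ε = 1 - ε := by ring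
    rw [e2] at hbern
    refine le_trans ?_ hbern
    have : (L : ℝ) * ε ≤ L * θ ^ j := by gcongr
    linarith
  obtain ⟨d, hd, J, hJ⟩ := no_decay (fun j => 1 - N (H ^ (s + 2 * p + j + 1))) (fun j => L * θ ^ j)
    (fun j => by linarith [hN1 (H ^ (s + 2 * p + j + 1))]) (fun j => by positivity)
    ((summable_geometric_of_lt_one hθ0 hθ1).mul_left _) hblock
  obtain ⟨C0, hC0⟩ := Nk_tendsto (φ := φ) h ξ d hd
  obtain ⟨k0, hk0⟩ := pow_unbounded_of_one_lt (C0 * (2 * p)) (by linarith : (1 : ℝ) < b)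
  have h1 := hJ (max J k0) (le_max_left _ _)
  set n := s + 2 * p + max J k0 + 1
  have hn : k0 ≤ H ^ n := by
    calc k0 ≤ n := by have := le_max_right J k0; omega
      _ ≤ H ^ n := (Nat.lt_pow_self (by omega)).le
  have h2 : C0 ≤ r * b ^ (H ^ n) / (2 * p) := by
    rw [le_div_iff₀ (by positivity)]
    have h3 : (b : ℝ) ^ k0 ≤ b ^ (H ^ n) := pow_le_pow_right₀ (by linarith) hn
    have h4 : 0 < (b : ℝ) ^ (H ^ n) := by positivity
    nlinarith
  have h3 := hC0 _ h2
  change 1 - d < N (H ^ n) at h3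
  linarith

theorem necessity (S : Sys p m F T) (E : EigFun p m T φ r q) (h : IsSpec F Λ) (hΛ : Λ.Countable) :
    ∃ n : ℤ, (p : ℤ) ∣ n ∧ r = n := by
  obtain ⟨a, b, ha, hab, hpb, hr⟩ := r_rat S E h
  have hb : 2 ≤ b := by
    have hb0 : b ≠ 0 := by
      rintro rfl
      have := E.one_lt
      rw [hr] at this
      norm_num at this
    exact S.hp.two_le.trans (Nat.le_of_dvd (Nat.pos_of_ne_zero hb0) hpb)
  rcases Nat.lt_or_ge 1 a with h1 | h1
  · exact (dai S E h hΛ h1 hb hab hr).elim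
  · have ha1 : a = 1 := by omega
    subst ha1
    exact ⟨b, Int.natCast_dvd_natCast.2 hpb, by rw [hr]; simp⟩

end

section

/-- The standing context. -/
structure Ctx (p : ℕ) (hp : p.Prime) (ρ₁ ρ₂ c : ℝ) (D : Fin p → (Fin 2 → ℤ)) (a : Fin 2 → ℤ)
    (μ : Measure (Fin 2 → ℝ)) (c₁ c₂ : ℤ) : Prop where
  h10 : 0 < ρ₁
  h11 : ρ₁ < 1
  h20 : 0 < ρ₂
  h21 : ρ₂ < 1
  hZ : ZeroSetCond p D a
  hD0 : D ⟨0, hp.pos⟩ = 0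
  hD11 : D ⟨1, hp.one_lt⟩ 1 = 0
  hD10 : D ⟨1, hp.one_lt⟩ 0 ≠ 0
  hμ : IsSelfAffine μ (Mupper ρ₁ ρ₂ c) (digitR D)
  hc2 : c₂ ≠ 0
  hcE : (c₁ : ℝ) * (ρ₂ - ρ₁) = c₂ * c * ρ₁ * ρ₂
  hna : ¬ (p : ℤ) ∣ c₂ * a 1 - c₁ * a 0

/-- transpose inverse -/
def Tc (ρ₁ ρ₂ c : ℝ) : V2 →ₗ[ℝ] V2 := Matrix.mulVecLin !![ρ₁, 0; -(c * ρ₁ * ρ₂), ρ₂]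

lemma Tc_0 (ρ₁ ρ₂ c : ℝ) (ξ : V2) : Tc ρ₁ ρ₂ c ξ 0 = ρ₁ * ξ 0 := by
  simp [Tc, Matrix.mulVec, dotProduct, Fin.sum_univ_two]

lemma Tc_1 (ρ₁ ρ₂ c : ℝ) (ξ : V2) : Tc ρ₁ ρ₂ c ξ 1 = -(c * ρ₁ * ρ₂) * ξ 0 + ρ₂ * ξ 1 := by
  simp [Tc, Matrix.mulVec, dotProduct, Fin.sum_univ_two]

lemma Mupper_inv {ρ₁ ρ₂ c : ℝ} (h1 : ρ₁ ≠ 0) (h2 : ρ₂ ≠ 0) :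
    (Mupper ρ₁ ρ₂ c)⁻¹ = !![ρ₁, -(c * ρ₁ * ρ₂); 0, ρ₂] := by
  apply Matrix.inv_eq_right_inv
  ext i j
  fin_cases i <;> fin_cases j <;> simp [Mupper, Matrix.mul_apply, Fin.sum_univ_two, h1, h2]
  field_simp
  ring

lemma expChar_Minv {ρ₁ ρ₂ c : ℝ} (h1 : ρ₁ ≠ 0) (h2 : ρ₂ ≠ 0) (ξ x : V2) :
    expChar ξ ((Mupper ρ₁ ρ₂ c)⁻¹.mulVec x) = expChar (Tc ρ₁ ρ₂ c ξ) x := by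
  rw [Mupper_inv h1 h2]
  unfold expChar
  rw [Tc_0, Tc_1]
  congr 3
  simp [Matrix.mulVec, dotProduct, Fin.sum_univ_two]
  ring

section
variable {p : ℕ} {hp : p.Prime} {ρ₁ ρ₂ c : ℝ} {D : Fin p → (Fin 2 → ℤ)} {a : Fin 2 → ℤ}
    {μ : Measure (Fin 2 → ℝ)} {c₁ c₂ : ℤ}

lemma mask_le {D : Fin p → V2} (hp : p.Prime) (ξ : V2) : ‖mask D ξ‖ ≤ 1 := by
  unfold mask
  rw [norm_mul, norm_inv, Complex.norm_natCast]
  have : ‖∑ i : Fin p, expChar ξ (D i)‖ ≤ p := by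
    refine (norm_sum_le _ _).trans ?_
    simp [expChar_norm]
  have hp0 : (0 : ℝ) < p := by exact_mod_cast hp.pos
  rw [inv_mul_le_iff₀ hp0]; simpa using this

lemma Ctx.recF (C : Ctx p hp ρ₁ ρ₂ c D a μ c₁ c₂) (ξ : V2) :
    ftMeasure μ ξ = mask (digitR D) (Tc ρ₁ ρ₂ c ξ) * ftMeasure μ (Tc ρ₁ ρ₂ c ξ) := by
  haveI := C.hμ.1
  have h1 : ρ₁ ≠ 0 := C.h10.ne'
  have h2 : ρ₂ ≠ 0 := C.h20.ne'
  have hmeas : ∀ i, Measurable (fun x : V2 => (Mupper ρ₁ ρ₂ c)⁻¹.mulVec (x + digitR D i)) := by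
    intro i
    have : Continuous (fun x : V2 => (Mupper ρ₁ ρ₂ c)⁻¹.mulVec (x + digitR D i)) :=
      Continuous.matrix_mulVec continuous_const (by fun_prop)
    exact this.measurable
  have e : ftMeasure μ ξ = ftMeasure ((p : ℝ≥0∞)⁻¹ • ∑ i : Fin p, μ.map (fun x => (Mupper ρ₁ ρ₂ c)⁻¹.mulVec (x + digitR D i))) ξ := by
    rw [← C.hμ.2.2]
  haveI : ∀ i, IsProbabilityMeasure (μ.map (fun x => (Mupper ρ₁ ρ₂ c)⁻¹.mulVec (x + digitR D i))) :=
    fun i => Measure.isProbabilityMeasure_map (hmeas i).aemeasurable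
  rw [e, ft_avg]
  unfold mask
  rw [mul_assoc, Finset.sum_mul]
  congr 1
  refine Finset.sum_congr rfl fun i _ => ?_
  unfold ftMeasure
  rw [integral_map (hmeas i).aemeasurable (expChar_continuous ξ).aestronglyMeasurable]
  rw [← integral_const_mul]
  refine integral_congr_ae (Filter.Eventually.of_forall fun x => ?_)
  simp only
  rw [expChar_Minv h1 h2, expChar_add_right, mul_comm]

lemma Ctx.zero_iff (C : Ctx p hp ρ₁ ρ₂ c D a μ c₁ c₂) (ξ : V2) :
    mask (digitR D) ξ = 0 ↔ ∃ j : ℤ, ¬ (p : ℤ) ∣ j ∧ ∃ k : Fin 2 → ℤ,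
      ∀ i, ξ i = (j : ℝ) * a i / p + k i := by
  have hp0 : (0 : ℝ) < p := by exact_mod_cast hp.pos
  rw [C.hZ.2]
  constructor
  · rintro ⟨j, h1, h2, k, hk⟩
    refine ⟨j, ?_, k, by simpa using hk⟩
    intro hd
    have := Int.le_of_dvd (by omega) hd
    have hp1 := hp.pos
    omega
  · rintro ⟨j, hj, k, hk⟩
    have hpZ : (0 : ℤ) < p := by exact_mod_cast hp.pos
    have h1 : 0 ≤ j % p := Int.emod_nonneg _ hpZ.ne'
    have h2 : j % p < p := Int.emod_lt_of_pos _ hpZ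
    have h3 : j % p ≠ 0 := fun h => hj (Int.dvd_of_emod_eq_zero h)
    refine ⟨(j % p).toNat, by omega, by omega, fun i => k i + (j / p) * a i, fun i => ?_⟩
    have h4 : (((j % p).toNat : ℕ) : ℝ) = ((j % p : ℤ) : ℝ) := by
      rw [← Int.cast_natCast, Int.toNat_of_nonneg h1]
    have h5 : (j : ℝ) = ((j % p : ℤ) : ℝ) + p * ((j / p : ℤ) : ℝ) := by
      have := Int.emod_add_mul_ediv j p
      exact_mod_cast this.symm
    rw [hk i, h4, h5]
    push_cast
    field_simp
    ring

lemma Ctx.not_dvd_a (C : Ctx p hp ρ₁ ρ₂ c D a μ c₁ c₂) (i : Fin 2) : ¬ (p : ℤ) ∣ a i := by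
  intro h
  have h1 := C.hZ.1 i
  have := Int.le_of_dvd (by omega) h
  omega

/-- far from the integers -/
lemma norm_one_add_exp (ε : ℝ) (hε : 0 < ε) : ∃ κ : ℝ, 0 ≤ κ ∧ κ < 2 ∧ ∀ t : ℝ, (∀ N : ℤ, ε ≤ |t - N|) →
    ‖1 + Complex.exp ((-2 * Real.pi * Complex.I) * (t : ℂ))‖ ≤ κ := by
  by_cases hε2 : ε ≤ 1 / 2
  · have hcos : Real.cos (2 * Real.pi * ε) < 1 := by
      have := Real.cos_lt_cos_of_nonneg_of_le_pi (x := 0) (y := 2 * Real.pi * ε) le_rfl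
        (by nlinarith [Real.pi_pos]) (by have := Real.pi_pos; positivity)
      simpa using this
    refine ⟨Real.sqrt (2 + 2 * Real.cos (2 * Real.pi * ε)), Real.sqrt_nonneg _, ?_, fun t ht => ?_⟩
    · rw [Real.sqrt_lt' (by norm_num)]
      linarith
    · apply Real.le_sqrt_of_sq_le
      have e1 : Complex.exp ((-2 * Real.pi * Complex.I) * (t : ℂ)) = Complex.exp (((-(2 * Real.pi * t) : ℝ) : ℂ) * Complex.I) := by
        congr 1; push_cast; ring
      have e2 : ‖1 + Complex.exp ((-2 * Real.pi * Complex.I) * (t : ℂ))‖ ^ 2 = 2 + 2 * Real.cos (2 * Real.pi * t) := by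
        rw [e1, Complex.sq_norm, Complex.normSq_apply, Complex.add_re, Complex.add_im,
          Complex.exp_ofReal_mul_I_re, Complex.exp_ofReal_mul_I_im, Real.cos_neg, Real.sin_neg]
        simp only [Complex.one_re, Complex.one_im]
        nlinarith [Real.sin_sq_add_cos_sq (2 * Real.pi * t)]
      rw [e2]
      have e3 : Real.cos (2 * Real.pi * t) = Real.cos (2 * Real.pi * |t - round t|) := by
        have : 2 * Real.pi * |t - round t| = |2 * Real.pi * t - (round t : ℤ) * (2 * Real.pi)| := by
          rw [← abs_of_pos (Real.two_pi_pos), ← abs_mul, abs_of_pos (Real.two_pi_pos)]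
          congr 1; ring
        rw [this, Real.cos_abs, Real.cos_sub_int_mul_two_pi]
      have h3 := abs_sub_round t
      have h4 := ht (round t)
      have h5 : Real.cos (2 * Real.pi * |t - round t|) ≤ Real.cos (2 * Real.pi * ε) := by
        apply Real.cos_le_cos_of_nonneg_of_le_pi
        · have := Real.pi_pos; positivity
        · nlinarith [Real.pi_pos]
        · have := Real.pi_pos; gcongr
      rw [e3]; linarith
  · refine ⟨0, le_rfl, by norm_num, fun t ht => ?_⟩
    exfalso
    have h3 := abs_sub_round t
    have h4 := ht (round t)
    linarith

lemma Ctx.mask_near (C : Ctx p hp ρ₁ ρ₂ c D a μ c₁ c₂) (i : Fin p) (hi : D i ≠ 0) (ε : ℝ) (hε : 0 < ε) :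
    ∃ θ : ℝ, 0 ≤ θ ∧ θ < 1 ∧ ∀ ξ : V2, (∀ N : ℤ, ε ≤ |(ξ 0 * D i 0 + ξ 1 * D i 1) - N|) →
      ‖mask (digitR D) ξ‖ ≤ θ := by
  obtain ⟨κ, hκ0, hκ2, hκ⟩ := norm_one_add_exp ε hε
  have hp0 : (0 : ℝ) < p := by exact_mod_cast hp.pos
  have hp2 : (2 : ℝ) ≤ p := by exact_mod_cast hp.two_le
  refine ⟨(p : ℝ)⁻¹ * (κ + (p - 2)), by
    have : 0 ≤ (p : ℝ) - 2 := by linarith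
    positivity, ?_, fun ξ hξ => ?_⟩
  · rw [inv_mul_lt_iff₀ hp0]; linarith
  · unfold mask
    rw [norm_mul, norm_inv, Complex.norm_natCast]
    refine mul_le_mul_of_nonneg_left ?_ (by positivity)
    set i0 : Fin p := ⟨0, hp.pos⟩ with hi0
    have hne : i ≠ i0 := by
      rintro rfl
      exact hi C.hD0
    rw [← Finset.add_sum_erase _ _ (Finset.mem_univ i0)]
    have hmem : i ∈ Finset.univ.erase i0 := Finset.mem_erase.2 ⟨hne, Finset.mem_univ _⟩
    rw [← Finset.add_sum_erase _ _ hmem, ← add_assoc]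
    refine (norm_add_le _ _).trans (add_le_add ?_ ?_)
    · have e0 : digitR D i0 = 0 := by
        ext j; simp [digitR, hi0, C.hD0]
      rw [e0, expChar_zero_right]
      exact hκ _ hξ
    · refine (norm_sum_le _ _).trans ?_
      simp only [expChar_norm, Finset.sum_const, nsmul_eq_mul, mul_one]
      rw [Finset.card_erase_of_mem hmem, Finset.card_erase_of_mem (Finset.mem_univ _), Finset.card_univ,
        Fintype.card_fin, Nat.sub_sub, Nat.cast_sub hp.two_le]
      norm_num
end

end

section

section
variable {p : ℕ} {hp : p.Prime} {ρ₁ ρ₂ c : ℝ} {D : Fin p → (Fin 2 → ℤ)} {a : Fin 2 → ℤ}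
    {μ : Measure (Fin 2 → ℝ)} {c₁ c₂ : ℤ}

/-- first eigenfunctional -/
def phi1 : V2 →ₗ[ℝ] ℝ := LinearMap.proj 0

/-- second eigenfunctional -/
def phi2 (c₁ c₂ : ℤ) : V2 →ₗ[ℝ] ℝ := (c₂ : ℝ) • LinearMap.proj 1 - (c₁ : ℝ) • LinearMap.proj 0

lemma phi1_apply (ξ : V2) : phi1 ξ = ξ 0 := rfl

lemma phi2_apply (ξ : V2) : phi2 c₁ c₂ ξ = c₂ * ξ 1 - c₁ * ξ 0 := by
  simp [phi2]

lemma Ctx.eig1 (_C : Ctx p hp ρ₁ ρ₂ c D a μ c₁ c₂) (ξ : V2) :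
    phi1 (Tc ρ₁ ρ₂ c ξ) = phi1 ξ / ρ₁⁻¹ := by
  rw [phi1_apply, phi1_apply, Tc_0, div_inv_eq_mul, mul_comm]

lemma Ctx.eig2 (C : Ctx p hp ρ₁ ρ₂ c D a μ c₁ c₂) (ξ : V2) :
    phi2 c₁ c₂ (Tc ρ₁ ρ₂ c ξ) = phi2 c₁ c₂ ξ / ρ₂⁻¹ := by
  rw [phi2_apply, phi2_apply, Tc_0, Tc_1, div_inv_eq_mul]
  have := C.hcE
  linear_combination (ξ 0) * this

lemma Ctx.tendsto (C : Ctx p hp ρ₁ ρ₂ c D a μ c₁ c₂) (ξ : V2) :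
    Filter.Tendsto (fun n => ((Tc ρ₁ ρ₂ c) ^ n) ξ) Filter.atTop (nhds 0) := by
  have h1 : ∀ n, phi1 (((Tc ρ₁ ρ₂ c) ^ n) ξ) = ρ₁ ^ n * phi1 ξ := by
    intro n
    induction n with
    | zero => simp
    | succ n ih =>
      rw [pow_succ', Module.End.mul_apply, C.eig1, ih, div_inv_eq_mul]; ring
  have h2 : ∀ n, phi2 c₁ c₂ (((Tc ρ₁ ρ₂ c) ^ n) ξ) = ρ₂ ^ n * phi2 c₁ c₂ ξ := by
    intro n
    induction n with
    | zero => simp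
    | succ n ih =>
      rw [pow_succ', Module.End.mul_apply, C.eig2, ih, div_inv_eq_mul]; ring
  have t1 : Filter.Tendsto (fun n => phi1 (((Tc ρ₁ ρ₂ c) ^ n) ξ)) Filter.atTop (nhds 0) := by
    simp_rw [h1]
    simpa using (tendsto_pow_atTop_nhds_zero_of_lt_one C.h10.le C.h11).mul_const (phi1 ξ)
  have t2 : Filter.Tendsto (fun n => phi2 c₁ c₂ (((Tc ρ₁ ρ₂ c) ^ n) ξ)) Filter.atTop (nhds 0) := by
    simp_rw [h2]
    simpa using (tendsto_pow_atTop_nhds_zero_of_lt_one C.h20.le C.h21).mul_const (phi2 c₁ c₂ ξ)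
  have hc2 : (c₂ : ℝ) ≠ 0 := by exact_mod_cast C.hc2
  rw [tendsto_pi_nhds]
  intro i
  fin_cases i
  · simpa [phi1_apply] using t1
  · have t3 := (t2.add (t1.const_mul (c₁ : ℝ))).div_const (c₂ : ℝ)
    simp only [phi2_apply, phi1_apply] at t3
    have e : ∀ n, (c₂ * ((Tc ρ₁ ρ₂ c) ^ n) ξ 1 - c₁ * ((Tc ρ₁ ρ₂ c) ^ n) ξ 0 + c₁ * ((Tc ρ₁ ρ₂ c) ^ n) ξ 0) / (c₂ : ℝ) = ((Tc ρ₁ ρ₂ c) ^ n) ξ 1 := by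
      intro n; field_simp; ring
    simp_rw [e] at t3
    simpa using t3

lemma isFT_prod {g : V2 → ℂ} (hg : IsFT g) (hp : p ≠ 0) (D : Fin p → V2) (T : V2 →ₗ[ℝ] V2) (k : ℕ) :
    IsFT (fun ξ => (∏ i ∈ Finset.range k, mask D ((T ^ (i + 1)) ξ)) * g ξ) := by
  induction k with
  | zero => simpa using hg
  | succ k ih =>
    have := ih.mul_mask hp D (T ^ (k + 1))
    refine (congrArg IsFT ?_).mp this
    funext ξ
    rw [Finset.prod_range_succ]; ring

lemma Ctx.Tinj (C : Ctx p hp ρ₁ ρ₂ c D a μ c₁ c₂) : Function.Injective (Tc ρ₁ ρ₂ c) := by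
  rw [← LinearMap.ker_eq_bot, LinearMap.ker_eq_bot']
  intro x hx
  have h0 := congrFun hx 0
  have h1 := congrFun hx 1
  rw [Tc_0] at h0
  rw [Tc_1] at h1
  simp only [Pi.zero_apply, mul_eq_zero, C.h10.ne', false_or] at h0
  rw [h0] at h1
  simp only [mul_zero, zero_add, Pi.zero_apply, mul_eq_zero, C.h20.ne', false_or] at h1
  ext i; fin_cases i
  · exact h0
  · exact h1

lemma Ctx.sys (C : Ctx p hp ρ₁ ρ₂ c D a μ c₁ c₂) :
    Sys p (mask (digitR D)) (ftMeasure μ) (Tc ρ₁ ρ₂ c) := by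
  haveI := C.hμ.1
  have hp0 : (0 : ℝ) < p := by exact_mod_cast hp.pos
  have hF : IsFT (ftMeasure μ) := ⟨μ, inferInstance, fun _ => rfl⟩
  have hFeq : ∀ (k : ℕ) (ξ : V2), ftMeasure μ ξ =
      (∏ i ∈ Finset.range k, mask (digitR D) (((Tc ρ₁ ρ₂ c) ^ (i + 1)) ξ)) * ftMeasure μ (((Tc ρ₁ ρ₂ c) ^ k) ξ) := by
    intro k ξ
    induction k with
    | zero => simp
    | succ k ih =>
      rw [ih, C.recF (((Tc ρ₁ ρ₂ c) ^ k) ξ), Finset.prod_range_succ, ← mul_assoc]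
      have : ((Tc ρ₁ ρ₂ c) ^ (k + 1)) ξ = (Tc ρ₁ ρ₂ c) (((Tc ρ₁ ρ₂ c) ^ k) ξ) := by rw [pow_succ']; rfl
      rw [this]
  refine ⟨hp, C.Tinj, LinearMap.injective_iff_surjective.1 C.Tinj, ?_, ?_, hF,
    fun ξ => mask_le hp ξ, C.recF, ?_, ?_, ?_, ?_⟩
  · intro k
    have := isFT_prod IsFT.one hp.ne_zero (digitR D) (Tc ρ₁ ρ₂ c) k
    simpa using this
  · intro k
    exact isFT_prod (hF.comp ((Tc ρ₁ ρ₂ c) ^ (k + 1))) hp.ne_zero (digitR D) (Tc ρ₁ ρ₂ c) k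
  · intro ξ h0
    have h1 : Filter.Tendsto (fun n => ftMeasure μ (((Tc ρ₁ ρ₂ c) ^ n) ξ)) Filter.atTop (nhds 1) := by
      have := ((ft_continuous μ).tendsto 0).comp (C.tendsto ξ)
      rwa [ft_zero] at this
    obtain ⟨k, hk⟩ := (h1.eventually (isOpen_ne.mem_nhds (one_ne_zero : (1 : ℂ) ≠ 0))).exists
    have h2 := hFeq k ξ
    rw [h0] at h2
    rcases mul_eq_zero.1 h2.symm with h3 | h3
    · obtain ⟨n, -, hn⟩ := Finset.prod_eq_zero_iff.1 h3
      exact ⟨n, hn⟩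
    · exact absurd h3 hk
  · refine Set.Countable.mono ?_ (Set.countable_range (fun x : ℤ × (Fin 2 → ℤ) =>
      (fun i => (x.1 : ℝ) * a i / p + x.2 i : V2)))
    intro ξ hξ
    obtain ⟨j, -, k, hk⟩ := (C.zero_iff ξ).1 hξ
    exact ⟨(j, k), funext fun i => (hk i).symm⟩
  · intro ζ₁ ζ₂ h1 h2
    obtain ⟨j1, hj1, k1, hk1⟩ := (C.zero_iff _).1 h1
    obtain ⟨j2, hj2, k2, hk2⟩ := (C.zero_iff _).1 h2
    by_cases hd : (p : ℤ) ∣ j1 - j2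
    · right
      obtain ⟨e, he⟩ := hd
      refine ⟨fun i => e * a i + k1 i - k2 i, fun i => ?_⟩
      have he' : (j1 : ℝ) = j2 + p * e := by
        have : j1 = j2 + p * e := by linarith
        exact_mod_cast this
      rw [Pi.sub_apply, hk1, hk2, he']
      push_cast
      field_simp
      ring
    · left
      rw [C.zero_iff]
      refine ⟨j1 - j2, hd, k1 - k2, fun i => ?_⟩
      rw [Pi.sub_apply, hk1, hk2]
      push_cast
      simp only [Pi.sub_apply]
      push_cast
      ring
  · intro ζ h
    obtain ⟨j, hj, k, hk⟩ := (C.zero_iff _).1 h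
    rw [C.zero_iff]
    refine ⟨-j, by rwa [Int.dvd_neg], -k, fun i => ?_⟩
    rw [Pi.neg_apply, hk]
    push_cast
    simp only [Pi.neg_apply]
    push_cast
    ring

lemma Ctx.eigFun1 (C : Ctx p hp ρ₁ ρ₂ c D a μ c₁ c₂) :
    EigFun p (mask (digitR D)) (Tc ρ₁ ρ₂ c) phi1 ρ₁⁻¹ (D ⟨1, hp.one_lt⟩ 0) := by
  have hp0 : (0 : ℝ) < p := by exact_mod_cast hp.pos
  have hpI : Prime (p : ℤ) := Nat.prime_iff_prime_int.1 hp
  refine ⟨(one_lt_inv₀ C.h10).2 C.h11, C.eig1, ?_, C.hD10, ⟨fun _ => 1, rfl⟩, ?_⟩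
  · intro ζ h
    obtain ⟨j, hj, k, hk⟩ := (C.zero_iff _).1 h
    refine ⟨j * a 0 + p * k 0, ?_, ?_⟩
    · intro hd
      have : (p : ℤ) ∣ j * a 0 := (Int.dvd_add_left (dvd_mul_right _ _)).1 hd
      rcases hpI.dvd_or_dvd this with h1 | h1
      · exact hj h1
      · exact C.not_dvd_a 0 h1
    · rw [phi1_apply, hk]; push_cast; field_simp
  · intro ε hε
    have hne : D ⟨1, hp.one_lt⟩ ≠ 0 := fun h => C.hD10 (by rw [h]; rfl)
    obtain ⟨θ, h0, h1, h2⟩ := C.mask_near _ hne ε hε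
    refine ⟨θ, h0, h1, fun ξ hξ => h2 ξ fun N => ?_⟩
    have := hξ N
    rw [phi1_apply] at this
    rw [C.hD11]
    convert this using 2
    push_cast; ring

lemma Ctx.exists_digit (C : Ctx p hp ρ₁ ρ₂ c D a μ c₁ c₂) : ∃ i, D i 1 ≠ 0 := by
  by_contra hcon
  push Not at hcon
  have hp0 : (0 : ℝ) < p := by exact_mod_cast hp.pos
  have h0 : mask (digitR D) (fun i => (a i : ℝ) / p) = 0 := by
    rw [C.zero_iff]
    refine ⟨1, hp.one_lt.ne' ∘ fun h => ?_, 0, fun i => by simp⟩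
    have := Int.le_of_dvd one_pos h
    have := hp.one_lt
    omega
  have h1 : mask (digitR D) (fun i => (a i : ℝ) / p + (if i = 1 then (1 / (2 * (p : ℝ)) : ℝ) else 0)) = 0 := by
    rw [← h0]
    unfold mask
    congr 1
    refine Finset.sum_congr rfl fun i _ => ?_
    unfold expChar
    simp [digitR, hcon i]
  obtain ⟨j, -, k, hk⟩ := (C.zero_iff _).1 h1
  have h2 := hk 1
  simp only [if_true] at h2
  field_simp at h2
  have h3 : (2 * a 1 + 1 : ℤ) = 2 * (j * a 1 + p * k 1) := by
    have : (2 * a 1 + 1 : ℝ) = 2 * (j * a 1 + p * k 1) := by linarith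
    exact_mod_cast this
  omega

lemma Ctx.eigFun2 (C : Ctx p hp ρ₁ ρ₂ c D a μ c₁ c₂) :
    ∃ q, EigFun p (mask (digitR D)) (Tc ρ₁ ρ₂ c) (phi2 c₁ c₂) ρ₂⁻¹ q := by
  have hp0 : (0 : ℝ) < p := by exact_mod_cast hp.pos
  have hpI : Prime (p : ℤ) := Nat.prime_iff_prime_int.1 hp
  have hc2 : (c₂ : ℝ) ≠ 0 := by exact_mod_cast C.hc2
  obtain ⟨i', hi'⟩ := C.exists_digit
  set i1 : Fin p := ⟨1, hp.one_lt⟩ with hi1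
  refine ⟨D i1 0 * D i' 1, (one_lt_inv₀ C.h20).2 C.h21, C.eig2, ?_, mul_ne_zero C.hD10 hi', ?_, ?_⟩
  · intro ζ h
    obtain ⟨j, hj, k, hk⟩ := (C.zero_iff _).1 h
    refine ⟨j * (c₂ * a 1 - c₁ * a 0) + p * (c₂ * k 1 - c₁ * k 0), ?_, ?_⟩
    · intro hd
      have : (p : ℤ) ∣ j * (c₂ * a 1 - c₁ * a 0) := (Int.dvd_add_left (dvd_mul_right _ _)).1 hd
      rcases hpI.dvd_or_dvd this with h1 | h1
      · exact hj h1
      · exact C.hna h1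
    · rw [phi2_apply, hk, hk]; push_cast; field_simp; ring
  · refine ⟨fun i => if i = 1 then (c₂ : ℝ)⁻¹ else 0, ?_⟩
    rw [phi2_apply]; simp [hc2]
  · intro ε hε
    have hne : D i1 ≠ 0 := fun h => C.hD10 (by rw [← hi1, h]; rfl)
    have hne' : D i' ≠ 0 := fun h => hi' (by rw [h]; rfl)
    set x : ℤ := -(c₁ * D i' 1 + c₂ * D i' 0) with hx
    set y : ℤ := c₂ * D i1 0 with hy
    set δ : ℝ := ε / (|(x : ℝ)| + |(y : ℝ)| + 1) with hδ
    have hden : 0 < |(x : ℝ)| + |(y : ℝ)| + 1 := by positivity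
    have hδ0 : 0 < δ := by positivity
    obtain ⟨θ, h0, h1, h2⟩ := C.mask_near _ hne δ hδ0
    obtain ⟨θ', h0', h1', h2'⟩ := C.mask_near _ hne' δ hδ0
    refine ⟨max θ θ', le_max_of_le_left h0, max_lt h1 h1', fun ξ hξ => ?_⟩
    by_cases hA : ∀ N : ℤ, δ ≤ |(ξ 0 * D i1 0 + ξ 1 * D i1 1) - N|
    · exact (h2 ξ hA).trans (le_max_left _ _)
    by_cases hB : ∀ N : ℤ, δ ≤ |(ξ 0 * D i' 0 + ξ 1 * D i' 1) - N|
    · exact (h2' ξ hB).trans (le_max_right _ _)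
    exfalso
    push Not at hA hB
    obtain ⟨N, hN⟩ := hA
    obtain ⟨N', hN'⟩ := hB
    have h3 := hξ (x * N + y * N')
    have e : ((D i1 0 * D i' 1 : ℤ) : ℝ) * phi2 c₁ c₂ ξ - ((x * N + y * N' : ℤ) : ℝ)
        = x * ((ξ 0 * D i1 0 + ξ 1 * D i1 1) - N) + y * ((ξ 0 * D i' 0 + ξ 1 * D i' 1) - N') := by
      rw [phi2_apply, C.hD11, hx, hy]
      push_cast
      ring
    rw [e] at h3
    have h4 := abs_add_le ((x : ℝ) * ((ξ 0 * D i1 0 + ξ 1 * D i1 1) - N)) (y * ((ξ 0 * D i' 0 + ξ 1 * D i' 1) - N'))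
    rw [abs_mul, abs_mul] at h4
    have h5 : |(x : ℝ)| * |(ξ 0 * D i1 0 + ξ 1 * D i1 1) - N| ≤ |(x : ℝ)| * δ := by gcongr
    have h6 : |(y : ℝ)| * |(ξ 0 * D i' 0 + ξ 1 * D i' 1) - N'| ≤ |(y : ℝ)| * δ := by gcongr
    have h7 : (|(x : ℝ)| + |(y : ℝ)| + 1) * δ = ε := by rw [hδ]; field_simp
    nlinarith

lemma isSpec_of_spectral [IsProbabilityMeasure μ] (h : IsSpectral μ) :
    ∃ Λ : Set V2, Λ.Countable ∧ IsSpec (ftMeasure μ) Λ := by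
  obtain ⟨Λ, hΛ, b, hb⟩ := h
  have hbe : ∀ x : Λ, b x = eLp μ (x : V2) := by
    intro x
    apply Lp.ext
    exact (hb x).trans (eLp_coe μ _).symm
  refine ⟨Λ, hΛ, ?_, ?_⟩
  · intro x hx y hy hxy
    have : inner ℂ (b ⟨y, hy⟩) (b ⟨x, hx⟩) = 0 := b.orthonormal.2 (fun h => hxy (congrArg Subtype.val h).symm)
    rwa [hbe, hbe, eLp_inner] at this
  · intro ξ
    have h1 := b.hasSum_inner_mul_inner (eLp μ (-ξ)) (eLp μ (-ξ))
    rw [eLp_inner, sub_self, ft_zero] at h1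
    have e : ∀ x : Λ, inner ℂ (eLp μ (-ξ)) (b x) * inner ℂ (b x) (eLp μ (-ξ)) = ((‖ftMeasure μ (ξ + x)‖ ^ 2 : ℝ) : ℂ) := by
      intro x
      rw [hbe, eLp_inner, eLp_inner]
      have e1 : (x : V2) - -ξ = ξ + x := by abel
      have e2 : -ξ - (x : V2) = -(ξ + x) := by abel
      rw [e1, e2, ft_neg, Complex.mul_conj, Complex.normSq_eq_norm_sq]
    simp_rw [e] at h1
    exact Complex.hasSum_ofReal.1 (by simpa using h1)

theorem Ctx.forward (C : Ctx p hp ρ₁ ρ₂ c D a μ c₁ c₂) (hg : Int.gcd c₁ c₂ = 1) (ℓ : ℕ) (m : ℤ)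
    (hc₂ : c₂ = (p : ℤ) ^ ℓ * m) (h : IsSpectral μ) :
    ∃ n₁ n₂ : ℤ, (p : ℤ) ∣ n₁ ∧ (p : ℤ) ∣ n₂ ∧ ρ₁⁻¹ = (n₁ : ℝ) ∧ ρ₂⁻¹ = (n₂ : ℝ) ∧
        (p : ℤ) ^ (ℓ + 1) ∣ (n₁ - n₂) := by
  haveI := C.hμ.1
  have hp0 : (0 : ℝ) < p := by exact_mod_cast hp.pos
  have hpI : Prime (p : ℤ) := Nat.prime_iff_prime_int.1 hp
  obtain ⟨Λ, hΛ, hS⟩ := isSpec_of_spectral h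
  obtain ⟨q, E2⟩ := C.eigFun2
  have E1 := C.eigFun1
  obtain ⟨n₁, hn1, h1⟩ := necessity C.sys E1 hS hΛ
  obtain ⟨n₂, hn2, h2⟩ := necessity C.sys E2 hS hΛ
  refine ⟨n₁, n₂, hn1, hn2, h1, h2, ?_⟩
  obtain ⟨ω, ⟨k, hk⟩, hω⟩ := exists_int_zero C.sys E1 hS
  obtain ⟨j, hj, K, hK⟩ := (C.zero_iff _).1 hω
  have a1 := E1.eig ω
  have a2 := E2.eig ω
  have hr1 := E1.one_lt
  have hr2 := E2.one_lt
  rw [h1] at a1 hr1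
  rw [h2] at a2 hr2
  rw [phi1_apply, phi1_apply, hK, hk] at a1
  rw [phi2_apply, phi2_apply, hK, hK, hk, hk] at a2
  have hn10 : (n₁ : ℝ) ≠ 0 := by linarith
  have hn20 : (n₂ : ℝ) ≠ 0 := by linarith
  field_simp at a1 a2
  set u : ℤ := j * a 0 + p * K 0 with hu
  set U : ℤ := j * a 1 + p * K 1 with hU
  have b1 : n₁ * u = p * k 0 := by
    have : (n₁ * u : ℝ) = p * k 0 := by rw [hu]; push_cast; linarith
    exact_mod_cast this
  have b2 : n₂ * (c₂ * U - c₁ * u) = p * (c₂ * k 1 - c₁ * k 0) := by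
    have : (n₂ * (c₂ * U - c₁ * u) : ℝ) = p * (c₂ * k 1 - c₁ * k 0) := by
      rw [hu, hU]; push_cast; linarith
    exact_mod_cast this
  have hpu : ¬ (p : ℤ) ∣ u := by
    intro hd
    have : (p : ℤ) ∣ j * a 0 := (Int.dvd_add_left (dvd_mul_right _ _)).1 hd
    rcases hpI.dvd_or_dvd this with h1 | h1
    · exact hj h1
    · exact C.not_dvd_a 0 h1
  have key : c₂ * (p * k 1 - n₂ * U) = c₁ * u * (n₁ - n₂) := by linear_combination -c₁ * b1 - b2
  rcases Nat.eq_zero_or_pos ℓ with hl | hl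
  · subst hl
    simpa using dvd_sub hn1 hn2
  · have hpc1 : ¬ (p : ℤ) ∣ c₁ := by
      intro hd
      have hd2 : (p : ℤ) ∣ c₂ := by
        rw [hc₂]; exact Dvd.dvd.mul_right (dvd_pow_self _ (by omega)) _
      have := Int.dvd_coe_gcd hd hd2
      rw [hg] at this
      have := Int.le_of_dvd one_pos this
      have := hp.one_lt
      push_cast at *
      omega
    have hd : (p : ℤ) ^ (ℓ + 1) ∣ c₁ * u * (n₁ - n₂) := by
      rw [← key, hc₂]
      obtain ⟨n', hn'⟩ := hn2
      refine ⟨m * (k 1 - n' * U), ?_⟩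
      rw [hn']; ring
    have hcop : IsCoprime ((p : ℤ) ^ (ℓ + 1)) (c₁ * u) := by
      apply IsCoprime.pow_left
      rw [Prime.coprime_iff_not_dvd hpI]
      intro h
      rcases hpI.dvd_or_dvd h with h | h
      · exact hpc1 h
      · exact hpu h
    exact hcop.dvd_of_dvd_mul_left hd
end

end

section

lemma exp_separates (ν : Measure V2) [IsFiniteMeasure ν] (g : V2 → ℝ) (hg : Integrable g ν)
    (h : ∀ ξ : V2, ∫ x, (g x : ℂ) * expChar ξ x ∂ν = 0) : g =ᵐ[ν] 0 := by
  have hn : Integrable (fun x => - g x) ν := hg.neg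
  have key : ∀ (g : V2 → ℝ), Integrable g ν → IsFiniteMeasure (ν.withDensity (fun x => ENNReal.ofReal (g x))) :=
    fun g hg => isFiniteMeasure_withDensity_ofReal hg.2
  haveI := key g hg
  haveI := key (fun x => - g x) hn
  have key2 : ∀ (g : V2 → ℝ), Integrable g ν → ∀ L : StrongDual ℝ V2,
      charFunDual (ν.withDensity (fun x => ENNReal.ofReal (g x))) L
        = ∫ x, ((max (g x) 0 : ℝ) : ℂ) * cexp (L x * I) ∂ν := by
    intro g hg L
    rw [charFunDual_apply, integral_withDensity_eq_integral_toReal_smul₀]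
    · refine integral_congr_ae (Filter.Eventually.of_forall fun x => ?_)
      simp only [ENNReal.toReal_ofReal']
      rw [Complex.real_smul]
    · exact hg.aemeasurable.ennreal_ofReal
    · exact Filter.Eventually.of_forall fun x => ENNReal.ofReal_lt_top
  have hgint : ∀ (g : V2 → ℝ), Integrable g ν → ∀ L : StrongDual ℝ V2,
      Integrable (fun x => (g x : ℂ) * cexp (L x * I)) ν := by
    intro g hg L
    refine Integrable.mul_bdd (c := 1) hg.ofReal ?_ ?_
    · exact (by fun_prop : Continuous fun x => cexp (L x * I)).aestronglyMeasurable
    · exact Filter.Eventually.of_forall fun x => (Complex.norm_exp_ofReal_mul_I _).le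
  have heq : ν.withDensity (fun x => ENNReal.ofReal (g x)) = ν.withDensity (fun x => ENNReal.ofReal (- g x)) := by
    apply Measure.ext_of_charFunDual
    funext L
    rw [key2 g hg, key2 (fun x => -g x) hn, ← sub_eq_zero, ← integral_sub]
    · have h0 := h (fun i => -(L (Pi.single i 1)) / (2 * Real.pi))
      rw [← h0]
      refine integral_congr_ae (Filter.Eventually.of_forall fun x => ?_)
      have hL : L x = x 0 * L (Pi.single 0 1) + x 1 * L (Pi.single 1 1) := by
        have : x = x 0 • (Pi.single 0 1 : V2) + x 1 • (Pi.single 1 1 : V2) := by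
          ext i; fin_cases i <;> simp
        conv_lhs => rw [this]
        simp
      have e1 : cexp (L x * I) = expChar (fun i => -(L (Pi.single i 1)) / (2 * Real.pi)) x := by
        unfold expChar
        rw [hL]
        congr 1
        have : (Real.pi : ℂ) ≠ 0 := by exact_mod_cast Real.pi_ne_zero
        push_cast
        field_simp
        ring
      simp only
      rw [e1, ← sub_mul]
      congr 1
      rw [← Complex.ofReal_sub]
      congr 1
      rcases le_total 0 (g x) with h | h
      · rw [max_eq_left h, max_eq_right (by linarith)]; ring
      · rw [max_eq_right h, max_eq_left (by linarith)]; ring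
    · exact hgint (fun x => max (g x) 0) hg.pos_part L
    · exact hgint (fun x => max (-g x) 0) hg.neg_part L
  rw [withDensity_eq_iff_of_sigmaFinite hg.aemeasurable.ennreal_ofReal hn.aemeasurable.ennreal_ofReal] at heq
  filter_upwards [heq] with x hx
  have := congrArg ENNReal.toReal hx
  rw [ENNReal.toReal_ofReal', ENNReal.toReal_ofReal'] at this
  simp only [Pi.zero_apply]
  rcases le_total 0 (g x) with h | h
  · rw [max_eq_left h, max_eq_right (by linarith)] at this; exact this
  · rw [max_eq_right h, max_eq_left (by linarith)] at this; linarith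

lemma eLp_dense (ν : Measure V2) [IsFiniteMeasure ν] (f : Lp ℂ 2 ν)
    (h : ∀ ξ, inner ℂ f (eLp ν ξ) = 0) : f = 0 := by
  have hf : Integrable f ν := (Lp.memLp f).integrable (by norm_num)
  have h1 : ∀ ξ, ∫ x, (starRingEnd ℂ) (f x) * expChar ξ x ∂ν = 0 := by
    intro ξ
    rw [← h ξ, MeasureTheory.L2.inner_def]
    refine integral_congr_ae ?_
    filter_upwards [eLp_coe ν ξ] with x hx
    rw [hx, RCLike.inner_apply, mul_comm]
  have h2 : ∀ ξ, ∫ x, f x * expChar ξ x ∂ν = 0 := by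
    intro ξ
    have := congrArg (starRingEnd ℂ) (h1 (-ξ))
    rw [← integral_conj, map_zero] at this
    rw [← this]
    refine integral_congr_ae (Filter.Eventually.of_forall fun x => ?_)
    simp [expChar_neg_left]
  have hi : ∀ ξ, Integrable (fun x => f x * expChar ξ x) ν := fun ξ =>
    hf.mul_bdd (c := 1) (expChar_continuous ξ).aestronglyMeasurable
      (Filter.Eventually.of_forall fun x => (expChar_norm ξ x).le)
  have hfc : Integrable (fun x => (starRingEnd ℂ) (f x)) ν := by
    refine (integrable_norm_iff ?_).1 ?_
    · exact Complex.continuous_conj.comp_aestronglyMeasurable hf.aestronglyMeasurable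
    · simpa using hf.norm
  have hi' : ∀ ξ, Integrable (fun x => (starRingEnd ℂ) (f x) * expChar ξ x) ν := fun ξ =>
    hfc.mul_bdd (c := 1) (expChar_continuous ξ).aestronglyMeasurable
      (Filter.Eventually.of_forall fun x => (expChar_norm ξ x).le)
  have hre : (fun x => (f x).re) =ᵐ[ν] 0 := by
    refine exp_separates ν _ hf.re fun ξ => ?_
    have : ∀ x, ((f x).re : ℂ) * expChar ξ x = (1 / 2 : ℂ) * (f x * expChar ξ x + (starRingEnd ℂ) (f x) * expChar ξ x) := by
      intro x
      rw [← add_mul, Complex.add_conj]; push_cast; ring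
    simp_rw [this]
    rw [integral_const_mul, integral_add (hi ξ) (hi' ξ), h1, h2]; simp
  have him : (fun x => (f x).im) =ᵐ[ν] 0 := by
    refine exp_separates ν _ hf.im fun ξ => ?_
    have : ∀ x, ((f x).im : ℂ) * expChar ξ x = (1 / (2 * I) : ℂ) * (f x * expChar ξ x - (starRingEnd ℂ) (f x) * expChar ξ x) := by
      intro x
      rw [← sub_mul, Complex.sub_conj]; push_cast; field_simp
    simp_rw [this]
    rw [integral_const_mul, integral_sub (hi ξ) (hi' ξ), h1, h2]; simp
  apply Lp.ext
  filter_upwards [hre, him, Lp.coeFn_zero ℂ 2 ν] with x h1 h2 h3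
  rw [h3]
  exact Complex.ext h1 h2

theorem spectral_of_seq (ν : Measure V2) [IsProbabilityMeasure ν] (l : ℕ → V2)
    (ho : ∀ i j, i ≠ j → ftMeasure ν (l i - l j) = 0)
    (hs : ∀ ξ, HasSum (fun i => ‖ftMeasure ν (ξ + l i)‖ ^ 2) 1) : IsSpectral ν := by
  have hinj : Function.Injective l := by
    intro i j hij
    by_contra hne
    have := ho i j hne
    rw [hij, sub_self, ft_zero] at this
    exact one_ne_zero this
  have hon : Orthonormal ℂ (fun x : Set.range l => eLp ν (x : V2)) := by
    refine ⟨fun x => eLp_norm ν _, ?_⟩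
    rintro ⟨_, i, rfl⟩ ⟨_, j, rfl⟩ hxy
    rw [eLp_inner]
    exact ho j i (fun h => hxy (by rw [h]))
  have hbot : (Submodule.span ℂ (Set.range (fun x : Set.range l => eLp ν (x : V2))))ᗮ = ⊥ := by
    rw [Submodule.eq_bot_iff]
    intro f hf
    apply eLp_dense
    intro ξ
    set x := eLp ν ξ with hx
    have hfv : ∀ i, inner ℂ (eLp ν (l i)) f = 0 := fun i =>
      (Submodule.mem_orthogonal _ _).1 hf _ (Submodule.subset_span ⟨⟨l i, i, rfl⟩, rfl⟩)
    have hsum : ∑' i, ‖inner ℂ (eLp ν (l i)) x‖ ^ 2 = 1 := by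
      rw [← (hs (-ξ)).tsum_eq]
      congr 1
      funext i
      rw [hx, eLp_inner, ← ft_norm_symm]
      congr 3
      abel
    have hon' : Orthonormal ℂ (fun i => eLp ν (l i)) := by
      have := hon.comp (fun i : ℕ => (⟨l i, i, rfl⟩ : Set.range l)) (fun i j h => hinj (congrArg Subtype.val h))
      exact this
    by_contra hne
    have hf0 : f ≠ 0 := by rintro rfl; simp at hne
    set α : ℂ := inner ℂ f x with hα
    have hb : ∀ s : ℂ, (1 : ℝ) ≤ ‖x - s • f‖ ^ 2 := by
      intro s
      rw [← hsum]
      refine le_trans (le_of_eq ?_) (hon'.tsum_inner_products_le (x - s • f))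
      congr 1
      funext i
      rw [inner_sub_right, inner_smul_right, hfv]; simp
    have hf2 : (0 : ℝ) < ‖f‖ ^ 2 := by positivity
    have h1 := hb (α / (‖f‖ ^ 2 : ℝ))
    have h2 := norm_sub_sq (𝕜 := ℂ) x ((α / (‖f‖ ^ 2 : ℝ)) • f)
    rw [h2, inner_smul_right, norm_smul, hx, eLp_norm, ← hx] at h1
    have h3 : inner ℂ x f = (starRingEnd ℂ) α := (inner_conj_symm x f).symm
    have h4 : α / ((‖f‖ ^ 2 : ℝ) : ℂ) * (starRingEnd ℂ) α = ((‖α‖ ^ 2 / ‖f‖ ^ 2 : ℝ) : ℂ) := by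
      rw [div_mul_eq_mul_div, Complex.mul_conj, Complex.normSq_eq_norm_sq]; push_cast; ring
    rw [h3, h4] at h1
    have h5 : ‖α / ((‖f‖ ^ 2 : ℝ) : ℂ)‖ = ‖α‖ / ‖f‖ ^ 2 := by
      rw [norm_div, Complex.norm_real, Real.norm_of_nonneg hf2.le]
    rw [h5] at h1
    have h6 : RCLike.re (((‖α‖ ^ 2 / ‖f‖ ^ 2 : ℝ) : ℂ)) = ‖α‖ ^ 2 / ‖f‖ ^ 2 := Complex.ofReal_re _
    rw [h6] at h1
    have h7 : (‖α‖ / ‖f‖ ^ 2 * ‖f‖) ^ 2 = ‖α‖ ^ 2 / ‖f‖ ^ 2 := by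
      have : ‖f‖ ≠ 0 := norm_ne_zero_iff.2 hf0
      field_simp
    rw [h7] at h1
    have hα0 : 0 < ‖α‖ := norm_pos_iff.2 hne
    have : 0 < ‖α‖ ^ 2 / ‖f‖ ^ 2 := by positivity
    linarith
  refine ⟨Set.range l, Set.countable_range l, HilbertBasis.mkOfOrthogonalEqBot hon hbot, fun x => ?_⟩
  rw [HilbertBasis.coe_mkOfOrthogonalEqBot]
  exact eLp_coe ν _

end

section

/-- Data for the construction of a spectrum. -/
structure Had (p : ℕ) (m F : V2 → ℂ) (T R : V2 →ₗ[ℝ] V2) (Γ : AddSubgroup V2) (b : ℕ → V2) : Prop where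
  hp : 1 < p
  TR : ∀ ξ, T (R ξ) = ξ
  b0 : b 0 = 0
  m0 : m 0 = 1
  mle : ∀ ξ, ‖m ξ‖ ≤ 1
  had : ∀ ξ, ∑ j ∈ Finset.range p, ‖m (ξ + b j)‖ ^ 2 = 1
  per : ∀ ξ, ∀ γ ∈ Γ, m (ξ + γ) = m ξ
  Rb : ∀ j, R (b j) ∈ Γ
  RΓ : ∀ γ ∈ Γ, R γ ∈ Γ
  recF : ∀ ξ, F ξ = m (T ξ) * F (T ξ)

def lamSeq (p : ℕ) (hp : 0 < p) (T R : V2 →ₗ[ℝ] V2) (b : ℕ → V2) (G : V2 → V2) (N : ℕ) : V2 :=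
  if hN : N = 0 then 0 else
    let k := Nat.log p N
    have : N % p ^ k < N :=
      lt_of_lt_of_le (Nat.mod_lt _ (pow_pos hp _)) (Nat.pow_log_le_self p hN)
    let l := lamSeq p hp T R b G (N % p ^ k)
    l + (R ^ (k + 1)) (b (N / p ^ k) + G ((T ^ (k + 1)) l + b (N / p ^ k)))
termination_by N

lemma lamSeq_zero (p : ℕ) (hp : 0 < p) (T R : V2 →ₗ[ℝ] V2) (b : ℕ → V2) (G : V2 → V2) :
    lamSeq p hp T R b G 0 = 0 := by
  rw [lamSeq]; simp

lemma lamSeq_step (p : ℕ) (hp : 0 < p) (T R : V2 →ₗ[ℝ] V2) (b : ℕ → V2) (G : V2 → V2)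
    (k r j : ℕ) (hr : r < p ^ k) (hj : j < p) (hj0 : j ≠ 0) :
    lamSeq p hp T R b G (r + p ^ k * j) = lamSeq p hp T R b G r +
      (R ^ (k + 1)) (b j + G ((T ^ (k + 1)) (lamSeq p hp T R b G r) + b j)) := by
  have hpk : 0 < p ^ k := pow_pos hp k
  have hN : r + p ^ k * j ≠ 0 := by positivity
  have h1 : p ^ k ≤ p ^ k * j := Nat.le_mul_of_pos_right _ (Nat.pos_of_ne_zero hj0)
  have hlog : Nat.log p (r + p ^ k * j) = k := by
    rw [Nat.log_eq_iff (by right; exact ⟨by omega, hN⟩)]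
    refine ⟨by omega, ?_⟩
    have : p ^ k * (j + 1) ≤ p ^ k * p := Nat.mul_le_mul_left _ hj
    rw [pow_succ]; rw [mul_add] at this; omega
  have hm : (r + p ^ k * j) % p ^ k = r := by
    rw [Nat.add_mul_mod_self_left, Nat.mod_eq_of_lt hr]
  have hd : (r + p ^ k * j) / p ^ k = j := by
    rw [Nat.add_mul_div_left _ _ hpk, Nat.div_eq_of_lt hr, zero_add]
  rw [lamSeq, dif_neg hN]
  simp only [hlog, hm, hd]

section
variable {p : ℕ} {m F : V2 → ℂ} {T R : V2 →ₗ[ℝ] V2} {Γ : AddSubgroup V2} {b : ℕ → V2} {G : V2 → V2}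

lemma Had.Rpow (H : Had p m F T R Γ b) (n : ℕ) {γ : V2} (h : γ ∈ Γ) : (R ^ n) γ ∈ Γ := by
  induction n with
  | zero => simpa using h
  | succ n ih => rw [pow_succ']; exact H.RΓ _ ih

lemma Had.Rpow' (H : Had p m F T R Γ b) (n : ℕ) (j : ℕ) {γ : V2} (h : γ ∈ Γ) :
    (R ^ (n + 1)) (b j + γ) ∈ Γ := by
  rw [map_add]
  refine Γ.add_mem ?_ (H.Rpow _ h)
  rw [pow_succ]
  exact H.Rpow n (H.Rb j)

lemma Had.TRpow (H : Had p m F T R Γ b) (n : ℕ) (ξ : V2) : (T ^ n) ((R ^ n) ξ) = ξ := by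
  induction n generalizing ξ with
  | zero => simp
  | succ n ih =>
    rw [pow_succ, pow_succ']
    change (T ^ n) (T (R ((R ^ n) ξ))) = ξ
    rw [H.TR, ih]

lemma Had.TRpow' (H : Had p m F T R Γ b) (i k : ℕ) (ξ : V2) :
    (T ^ i) ((R ^ (i + k)) ξ) = (R ^ k) ξ := by
  rw [pow_add]
  exact H.TRpow i _

/-- structure of the sequence -/
lemma Had.step (H : Had p m F T R Γ b) (hp : 0 < p) (hG : ∀ y, G y ∈ Γ) (k r j : ℕ) (hr : r < p ^ k) (hj : j < p) :
    ∃ g ∈ Γ, lamSeq p hp T R b G (r + p ^ k * j) = lamSeq p hp T R b G r + (R ^ (k + 1)) (b j + g) ∧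
      (j ≠ 0 → g = G ((T ^ (k + 1)) (lamSeq p hp T R b G r) + b j)) := by
  by_cases h0 : j = 0
  · subst h0
    exact ⟨0, Γ.zero_mem, by simp [H.b0], by simp⟩
  · exact ⟨_, hG _, lamSeq_step p hp T R b G k r j hr hj h0, fun _ => rfl⟩

lemma sum_range_mul' (f : ℕ → ℝ) (a b : ℕ) :
    ∑ N ∈ Finset.range (a * b), f N = ∑ r ∈ Finset.range a, ∑ j ∈ Finset.range b, f (r + a * j) := by
  induction b with
  | zero => simp
  | succ b ih =>
    rw [mul_add, mul_one, Finset.sum_range_add, ih]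
    simp_rw [Finset.sum_range_succ]
    rw [Finset.sum_add_distrib]
    congr 1
    exact Finset.sum_congr rfl fun r _ => by rw [add_comm]

/-- finite product -/
def maskProd (m : V2 → ℂ) (T : V2 →ₗ[ℝ] V2) (k : ℕ) (ξ : V2) : ℂ := ∏ i ∈ Finset.range k, m ((T ^ (i + 1)) ξ)

lemma Had.F_eq (H : Had p m F T R Γ b) (k : ℕ) (ξ : V2) : F ξ = maskProd m T k ξ * F ((T ^ k) ξ) := by
  induction k with
  | zero => simp [maskProd]
  | succ k ih =>
    rw [ih, H.recF ((T ^ k) ξ), maskProd, maskProd, Finset.prod_range_succ, ← mul_assoc]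
    rw [pow_succ' T k]; rfl

lemma Had.sum_one (H : Had p m F T R Γ b) (hp : 0 < p) (hG : ∀ y, G y ∈ Γ) (k : ℕ) (ξ : V2) :
    ∑ N ∈ Finset.range (p ^ k), ‖maskProd m T k (ξ + lamSeq p hp T R b G N)‖ ^ 2 = 1 := by
  induction k with
  | zero => simp [maskProd]
  | succ k ih =>
    rw [pow_succ, sum_range_mul', ← ih]
    refine Finset.sum_congr rfl fun r hr => ?_
    rw [Finset.mem_range] at hr
    have key : ∀ j ∈ Finset.range p, ‖maskProd m T (k + 1) (ξ + lamSeq p hp T R b G (r + p ^ k * j))‖ ^ 2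
        = ‖maskProd m T k (ξ + lamSeq p hp T R b G r)‖ ^ 2 *
          ‖m ((T ^ (k + 1)) (ξ + lamSeq p hp T R b G r) + b j)‖ ^ 2 := by
      intro j hj
      rw [Finset.mem_range] at hj
      obtain ⟨g, hg, h, -⟩ := H.step hp hG k r j hr hj
      rw [h, ← mul_pow, ← norm_mul]
      congr 2
      rw [maskProd, Finset.prod_range_succ, maskProd]
      congr 1
      · refine Finset.prod_congr rfl fun i hi => ?_
        rw [Finset.mem_range] at hi
        rw [← add_assoc, map_add]
        apply H.per
        obtain ⟨t, rfl⟩ := Nat.exists_eq_add_of_lt hi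
        have : i + t + 1 + 1 = (i + 1) + (t + 1) := by ring
        rw [this, H.TRpow']
        exact H.Rpow' t j hg
      · rw [← add_assoc, map_add, H.TRpow, ← add_assoc]
        exact H.per _ _ hg
    rw [Finset.sum_congr rfl key, ← Finset.mul_sum, H.had, mul_one]

lemma maskProd_zero (hm : m 0 = 1) (k : ℕ) : maskProd m T k 0 = 1 := by
  simp [maskProd, hm]

lemma Had.ortho (H : Had p m F T R Γ b) (hp : 0 < p) (hG : ∀ y, G y ∈ Γ) (i j : ℕ) (hij : i ≠ j) :
    F (lamSeq p hp T R b G i - lamSeq p hp T R b G j) = 0 := by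
  set k := max i j with hk
  have hi : i < p ^ k := lt_of_le_of_lt (le_max_left i j) (Nat.lt_pow_self H.hp)
  have hj : j < p ^ k := lt_of_le_of_lt (le_max_right i j) (Nat.lt_pow_self H.hp)
  have h1 := H.sum_one hp hG k (-(lamSeq p hp T R b G j))
  rw [← Finset.add_sum_erase _ _ (Finset.mem_range.2 hj)] at h1
  rw [neg_add_cancel, maskProd_zero H.m0] at h1
  have h2 : ∑ N ∈ (Finset.range (p ^ k)).erase j, ‖maskProd m T k (-(lamSeq p hp T R b G j) + lamSeq p hp T R b G N)‖ ^ 2 = 0 := by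
    simp at h1 ⊢
    linarith
  rw [Finset.sum_eq_zero_iff_of_nonneg (fun _ _ => by positivity)] at h2
  have h3 := h2 i (Finset.mem_erase.2 ⟨hij, Finset.mem_range.2 hi⟩)
  have h4 : maskProd m T k (lamSeq p hp T R b G i - lamSeq p hp T R b G j) = 0 := by
    rw [sub_eq_neg_add]
    simpa using h3
  rw [H.F_eq k, h4, zero_mul]

lemma Had.lower (H : Had p m F T R Γ b) (hp : 0 < p) (hG : ∀ y, G y ∈ Γ) (hF0 : F 0 = 1)
    {δ : ℝ} (hδ : δ ≤ 1) (hGδ : ∀ y, δ ≤ ‖F (y + G y)‖) (k N : ℕ) (hN : N < p ^ k) :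
    δ ≤ ‖F ((T ^ k) (lamSeq p hp T R b G N))‖ := by
  induction k generalizing N with
  | zero =>
    have : N = 0 := by simpa using hN
    subst this
    rw [lamSeq_zero]; simpa [hF0] using hδ
  | succ k ih =>
    have hpk : 0 < p ^ k := pow_pos hp k
    have hr : N % p ^ k < p ^ k := Nat.mod_lt _ hpk
    have hj : N / p ^ k < p := by rw [Nat.div_lt_iff_lt_mul hpk, mul_comm, ← pow_succ]; exact hN
    have hNe : N % p ^ k + p ^ k * (N / p ^ k) = N := Nat.mod_add_div _ _
    obtain ⟨g, hg, h, h'⟩ := H.step hp hG k _ _ hr hj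
    by_cases h0 : N / p ^ k = 0
    · have hlt : N < p ^ k := by
        rw [h0] at hNe; omega
      refine (ih N hlt).trans ?_
      rw [H.recF, norm_mul, pow_succ']
      exact mul_le_of_le_one_left (norm_nonneg _) (H.mle _)
    · rw [hNe] at h
      rw [h, map_add, H.TRpow, h' h0, ← add_assoc]
      exact hGδ _

lemma Had.hasSum {ν : Measure V2} [IsProbabilityMeasure ν] (H : Had p m (ftMeasure ν) T R Γ b) (hp : 0 < p)
    (hG : ∀ y, G y ∈ Γ) {δ : ℝ} (hδ0 : 0 < δ) (hGδ : ∀ y, δ ≤ ‖ftMeasure ν (y + G y)‖)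
    (hT : ∀ ξ, Filter.Tendsto (fun n => (T ^ n) ξ) Filter.atTop (nhds 0)) (ξ : V2) :
    HasSum (fun i => ‖ftMeasure ν (ξ + lamSeq p hp T R b G i)‖ ^ 2) 1 := by
  set F := ftMeasure ν with hF
  set l := lamSeq p hp T R b G with hl
  have hF0 : F 0 = 1 := ft_zero ν
  have hδ1 : δ ≤ 1 := (hGδ 0).trans (ft_norm_le ν _)
  -- summability by Bessel
  have hon : Orthonormal ℂ (fun i => eLp ν (l i)) := by
    refine ⟨fun x => eLp_norm ν _, ?_⟩
    intro i j hij
    change inner ℂ (eLp ν (l i)) (eLp ν (l j)) = 0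
    rw [eLp_inner]
    exact H.ortho hp hG j i hij.symm
  have hsm : Summable (fun i => ‖F (ξ + l i)‖ ^ 2) := by
    refine (hon.inner_products_summable (eLp ν (-ξ))).congr fun i => ?_
    rw [eLp_inner, ← ft_norm_symm]
    congr 3
    abel
  -- eventual lower bound
  have hlow : ∀ᶠ k in Filter.atTop, ∀ N < p ^ k, δ / 2 ≤ ‖F ((T ^ k) (ξ + l N))‖ := by
    have := (hT ξ).eventually (ft_modulus ν (δ / 2) (by positivity))
    filter_upwards [this] with k hk N hN
    have h1 := hk ((T ^ k) (l N))
    have h2 := H.lower hp hG hF0 hδ1 hGδ k N hN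
    have h3 : (T ^ k) (l N) + (T ^ k) ξ = (T ^ k) (ξ + l N) := by rw [map_add, add_comm]
    rw [h3] at h1
    have h4 := norm_sub_norm_le (F ((T ^ k) (l N))) (F ((T ^ k) (ξ + l N)))
    rw [norm_sub_rev] at h4
    change ‖F _ - F _‖ < _ at h1
    change δ ≤ ‖F ((T ^ k) (l N))‖ at h2
    linarith
  have hFk : ∀ N, Filter.Tendsto (fun k => ‖F ((T ^ k) (ξ + l N))‖ ^ 2) Filter.atTop (nhds 1) := by
    intro N
    have h1 := ((ft_continuous ν).tendsto 0).comp (hT (ξ + l N))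
    have h2 := (h1.norm).pow 2
    change Filter.Tendsto (fun k => ‖F ((T ^ k) (ξ + l N))‖ ^ 2) Filter.atTop (nhds (‖F 0‖ ^ 2)) at h2
    simpa [hF0] using h2
  have htend := tendsto_tsum_of_dominated_convergence (𝓕 := Filter.atTop)
    (f := fun k N => if N < p ^ k then ‖maskProd m T k (ξ + l N)‖ ^ 2 else 0)
    (g := fun N => ‖F (ξ + l N)‖ ^ 2) (bound := fun N => (δ / 2)⁻¹ ^ 2 * ‖F (ξ + l N)‖ ^ 2)
    (hsm.mul_left _) ?_ ?_
  · have hone : ∀ k, (∑' N, if N < p ^ k then ‖maskProd m T k (ξ + l N)‖ ^ 2 else 0) = 1 := by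
      intro k
      rw [tsum_eq_sum (s := Finset.range (p ^ k))]
      · rw [← H.sum_one hp hG k ξ]
        refine Finset.sum_congr rfl fun N hN => ?_
        rw [if_pos (Finset.mem_range.1 hN)]
      · intro N hN
        rw [if_neg (fun h => hN (Finset.mem_range.2 h))]
    simp_rw [hone] at htend
    have := tendsto_nhds_unique tendsto_const_nhds htend
    rw [this]
    exact hsm.hasSum
  · intro N
    have h1 : Filter.Tendsto (fun k => ‖F (ξ + l N)‖ ^ 2 / ‖F ((T ^ k) (ξ + l N))‖ ^ 2) Filter.atTop
        (nhds (‖F (ξ + l N)‖ ^ 2)) := by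
      have := (tendsto_const_nhds (x := ‖F (ξ + l N)‖ ^ 2)).div (hFk N) one_ne_zero
      rw [div_one] at this
      exact this
    refine h1.congr' ?_
    filter_upwards [hlow, Filter.eventually_ge_atTop N] with k hk hkN
    have hNk : N < p ^ k := lt_of_le_of_lt hkN (Nat.lt_pow_self H.hp)
    have h2 := hk N hNk
    have h3 : ‖F ((T ^ k) (ξ + l N))‖ ≠ 0 := by linarith
    rw [if_pos hNk, H.F_eq k (ξ + l N), norm_mul]
    field_simp
  · filter_upwards [hlow] with k hk N
    by_cases hN : N < p ^ k
    · rw [if_pos hN, H.F_eq k (ξ + l N), norm_mul, mul_pow]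
      have h2 := hk N hN
      rw [Real.norm_of_nonneg (by positivity)]
      have h3 : 1 ≤ (δ / 2)⁻¹ * ‖F ((T ^ k) (ξ + l N))‖ := by
        rw [← div_eq_inv_mul, one_le_div (by positivity)]; exact h2
      have h4 : 1 ≤ ((δ / 2)⁻¹ * ‖F ((T ^ k) (ξ + l N))‖) ^ 2 := one_le_pow₀ h3
      calc ‖maskProd m T k (ξ + l N)‖ ^ 2 = ‖maskProd m T k (ξ + l N)‖ ^ 2 * 1 := by ring
        _ ≤ ‖maskProd m T k (ξ + l N)‖ ^ 2 * ((δ / 2)⁻¹ * ‖F ((T ^ k) (ξ + l N))‖) ^ 2 := by gcongr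
        _ = _ := by ring
    · rw [if_neg hN, norm_zero]; positivity

theorem Had.spectral {ν : Measure V2} [IsProbabilityMeasure ν] (H : Had p m (ftMeasure ν) T R Γ b)
    (hG : ∀ y, G y ∈ Γ) {δ : ℝ} (hδ0 : 0 < δ) (hGδ : ∀ y, δ ≤ ‖ftMeasure ν (y + G y)‖)
    (hT : ∀ ξ, Filter.Tendsto (fun n => (T ^ n) ξ) Filter.atTop (nhds 0)) : IsSpectral ν := by
  have hp : 0 < p := by have := H.hp; omega
  exact spectral_of_seq ν (lamSeq p hp T R b G) (H.ortho hp hG) (H.hasSum hp hG hδ0 hGδ hT)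

end

end

section

section
variable {p : ℕ} {hp : p.Prime} {ρ₁ ρ₂ c : ℝ} {D : Fin p → (Fin 2 → ℤ)} {a : Fin 2 → ℤ}
    {μ : Measure (Fin 2 → ℝ)} {c₁ c₂ : ℤ}

/-- The lattice mℤ × ℤ. -/
def Gam (m : ℤ) : AddSubgroup V2 where
  carrier := {ξ | ∃ s t : ℤ, ξ 0 = m * s ∧ ξ 1 = t}
  zero_mem' := ⟨0, 0, by simp, by simp⟩
  add_mem' := by
    rintro x y ⟨s, t, h1, h2⟩ ⟨s', t', h1', h2'⟩
    refine ⟨s + s', t + t', ?_, ?_⟩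
    · simp only [Pi.add_apply, h1, h1']; push_cast; ring
    · simp only [Pi.add_apply, h2, h2']; push_cast; ring
  neg_mem' := by
    rintro x ⟨s, t, h1, h2⟩
    refine ⟨-s, -t, ?_, ?_⟩
    · simp only [Pi.neg_apply, h1]; push_cast; ring
    · simp only [Pi.neg_apply, h2]; push_cast; ring

lemma mem_Gam {m : ℤ} {ξ : V2} : ξ ∈ Gam m ↔ ∃ s t : ℤ, ξ 0 = m * s ∧ ξ 1 = t := Iff.rfl

/-- the inverse of `Tc` -/
def Rc (n₁ n₂ : ℤ) (c : ℝ) : V2 →ₗ[ℝ] V2 := Matrix.mulVecLin !![(n₁ : ℝ), 0; c, (n₂ : ℝ)]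

lemma Rc_0 (n₁ n₂ : ℤ) (c : ℝ) (ξ : V2) : Rc n₁ n₂ c ξ 0 = n₁ * ξ 0 := by
  simp [Rc, Matrix.mulVec, dotProduct, Fin.sum_univ_two]

lemma Rc_1 (n₁ n₂ : ℤ) (c : ℝ) (ξ : V2) : Rc n₁ n₂ c ξ 1 = c * ξ 0 + n₂ * ξ 1 := by
  simp [Rc, Matrix.mulVec, dotProduct, Fin.sum_univ_two]

lemma mask_per (D : Fin p → (Fin 2 → ℤ)) (ξ γ : V2) (k : Fin 2 → ℤ) (h : ∀ i, γ i = k i) :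
    mask (digitR D) (ξ + γ) = mask (digitR D) ξ := by
  unfold mask
  congr 1
  refine Finset.sum_congr rfl fun i _ => ?_
  rw [expChar_add_left]
  have : expChar γ (digitR D i) = 1 := by
    unfold expChar
    rw [Complex.exp_eq_one_iff]
    refine ⟨-(k 0 * D i 0 + k 1 * D i 1), ?_⟩
    simp only [h, digitR]
    push_cast
    ring
  rw [this, mul_one]

lemma mask_zero (hp : p.Prime) (D : Fin p → V2) : mask D 0 = 1 := by
  have : (p : ℂ) ≠ 0 := by exact_mod_cast hp.ne_zero
  simp [mask, expChar_zero_left, this]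

lemma had_sum (hp : p.Prime) (D : Fin p → V2) (b : ℕ → V2)
    (hb : ∀ i j, i < p → j < p → i ≠ j → mask D (b i - b j) = 0) (ξ : V2) :
    ∑ j ∈ Finset.range p, ‖mask D (ξ + b j)‖ ^ 2 = 1 := by
  have hp0 : (0 : ℝ) < p := by exact_mod_cast hp.pos
  have hpc : (p : ℂ) ≠ 0 := by exact_mod_cast hp.ne_zero
  set w : V2 → EuclideanSpace ℂ (Fin p) := fun ζ => WithLp.toLp 2 (fun i => ((Real.sqrt p)⁻¹ : ℝ) * expChar ζ (D i)) with hw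
  have hinner : ∀ ζ η, inner ℂ (w ζ) (w η) = mask D (η - ζ) := by
    intro ζ η
    rw [PiLp.inner_apply]
    simp only [hw, RCLike.inner_apply]
    unfold mask
    rw [Finset.mul_sum]
    refine Finset.sum_congr rfl fun i _ => ?_
    rw [map_mul, sub_eq_add_neg, expChar_add_left, expChar_neg_left, Complex.conj_ofReal]
    have e : (((Real.sqrt p)⁻¹ : ℝ) : ℂ) * (((Real.sqrt p)⁻¹ : ℝ) : ℂ) = (p : ℂ)⁻¹ := by
      rw [← Complex.ofReal_mul, ← mul_inv, Real.mul_self_sqrt hp0.le]; simp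
    rw [← e]; ring
  have hnorm : ∀ ζ, ‖w ζ‖ = 1 := by
    intro ζ
    have h1 := hinner ζ ζ
    rw [sub_self, mask_zero hp, inner_self_eq_norm_sq_to_K] at h1
    have h2 : ‖w ζ‖ ^ 2 = 1 := by
      apply Complex.ofReal_eq_one.1
      rw [Complex.ofReal_pow]
      exact h1
    have := norm_nonneg (w ζ)
    nlinarith
  have hon : Orthonormal ℂ (fun j : Fin p => w (-(b j))) := by
    refine ⟨fun j => hnorm _, fun i j hij => ?_⟩
    change inner ℂ (w _) (w _) = 0
    rw [hinner]
    have : -b (j : ℕ) - -b (i : ℕ) = b i - b j := by abel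
    rw [this]
    exact hb i j i.2 j.2 (fun h => hij (Fin.ext h))
  have hspan : ⊤ ≤ Submodule.span ℂ (Set.range (fun j : Fin p => w (-(b j)))) := by
    rw [hon.linearIndependent.span_eq_top_of_card_eq_finrank' (by simp)]
  have h := (OrthonormalBasis.mk hon hspan).sum_sq_norm_inner_right (w ξ)
  rw [hnorm, one_pow] at h
  rw [Finset.sum_range, ← h]
  refine Finset.sum_congr rfl fun j _ => ?_
  rw [OrthonormalBasis.coe_mk, hinner]
  simp

lemma two_le_of_inv {ρ : ℝ} (h0 : 0 < ρ) (h1 : ρ < 1) {n : ℤ} (h : ρ⁻¹ = n) : 2 ≤ n := by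
  have := (one_lt_inv₀ h0).2 h1
  rw [h] at this
  have : (1 : ℤ) < n := by exact_mod_cast this
  omega

lemma Ctx.exists_ne (C : Ctx p hp ρ₁ ρ₂ c D a μ c₁ c₂) {m n₁ n₂ : ℤ} (hm : ¬ (p : ℤ) ∣ m)
    (hn1 : (p : ℤ) ∣ n₁) (hn2 : (p : ℤ) ∣ n₂) (h1 : ρ₁⁻¹ = n₁) (h2 : ρ₂⁻¹ = n₂) (y : V2) :
    ∃ γ ∈ Gam m, ftMeasure μ (y + γ) ≠ 0 := by
  by_contra hcon
  push Not at hcon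
  have hp0 : (0 : ℝ) < p := by exact_mod_cast hp.pos
  have hpI : Prime (p : ℤ) := Nat.prime_iff_prime_int.1 hp
  have h21 := two_le_of_inv C.h10 C.h11 h1
  have h22 := two_le_of_inv C.h20 C.h21 h2
  obtain ⟨n₁', hn1'⟩ := hn1
  obtain ⟨n₂', hn2'⟩ := hn2
  obtain ⟨q, E2⟩ := C.eigFun2
  have E1 := C.eigFun1
  have hz : ∀ ξ, ftMeasure μ ξ = 0 → ∃ n : ℕ, ∃ u v : ℤ, ¬ (p : ℤ) ∣ u ∧ ξ 0 = n₁ ^ n * n₁' * u ∧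
      c₂ * ξ 1 - c₁ * ξ 0 = n₂ ^ n * n₂' * v := by
    intro ξ hξ
    obtain ⟨n, hn⟩ := C.sys.zero ξ hξ
    obtain ⟨u, hu, hu'⟩ := E1.zero _ hn
    obtain ⟨v, hv, hv'⟩ := E2.zero _ hn
    rw [E1.eig_pow, h1, phi1_apply] at hu'
    rw [E2.eig_pow, h2, phi2_apply] at hv'
    have hn10 : (n₁ : ℝ) ≠ 0 := by exact_mod_cast (by omega : n₁ ≠ 0)
    have hn20 : (n₂ : ℝ) ≠ 0 := by exact_mod_cast (by omega : n₂ ≠ 0)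
    refine ⟨n, u, v, hu, ?_, ?_⟩
    · have e : (n₁ : ℝ) = p * n₁' := by exact_mod_cast hn1'
      have : ξ 0 = n₁ ^ n * n₁ * (u / p) := by
        rw [← hu']; field_simp; ring
      rw [this]; conv_lhs => enter [1, 2]; rw [e]
      field_simp
    · have e : (n₂ : ℝ) = p * n₂' := by exact_mod_cast hn2'
      have : c₂ * ξ 1 - c₁ * ξ 0 = n₂ ^ n * n₂ * (v / p) := by
        rw [← hv']; field_simp; ring
      rw [this]; conv_lhs => enter [1, 2]; rw [e]
      field_simp
  have hy : ∃ Y : ℤ, y 0 = Y := by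
    obtain ⟨n, u, v, -, hu, -⟩ := hz _ (hcon 0 (Gam m).zero_mem)
    rw [add_zero] at hu
    exact ⟨n₁ ^ n * n₁' * u, by rw [hu]; push_cast; ring⟩
  obtain ⟨Y, hY⟩ := hy
  set N : ℕ := c₂.natAbs with hN
  set K : ℕ := (n₁ ^ (N + 1)).natAbs with hK
  have hcop : IsCoprime ((p : ℤ) ^ K) m := by
    apply IsCoprime.pow_left
    rw [Prime.coprime_iff_not_dvd hpI]; exact hm
  obtain ⟨x, z, hxz⟩ := hcop
  -- choose s = - Y z
  have hlarge : ∀ t : ℤ, ∃ n : ℕ, N ≤ n ∧ ∃ v : ℤ,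
      c₂ * (y 1 + t) - c₁ * (Y + m * (-(Y * z) : ℤ) : ℝ) = n₂ ^ n * n₂' * v := by
    intro t
    have hγ : (fun i => if i = 0 then (m : ℝ) * (-(Y * z) : ℤ) else (t : ℝ)) ∈ Gam m :=
      ⟨-(Y * z), t, by simp, by simp⟩
    obtain ⟨n, u, v, hu, e1, e2⟩ := hz _ (hcon _ hγ)
    simp only [Pi.add_apply, if_true, hY, one_ne_zero, if_false] at e1 e2
    refine ⟨n, ?_, v, e2⟩
    by_contra hlt
    push Not at hlt
    have e3 : Y + m * (-(Y * z)) = n₁ ^ n * n₁' * u := by exact_mod_cast e1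
    have e4 : (p : ℤ) ^ K ∣ n₁ ^ (n + 1) * u := by
      have : (p : ℤ) ^ K ∣ n₁ ^ n * n₁' * u := ⟨Y * x, by rw [← e3]; linear_combination (-Y) * hxz⟩
      refine this.trans ⟨p, ?_⟩
      rw [pow_succ, hn1']; ring
    have e5 : (p : ℤ) ^ K ∣ n₁ ^ (n + 1) := by
      refine IsCoprime.dvd_of_dvd_mul_right ?_ e4
      apply IsCoprime.pow_left
      rw [Prime.coprime_iff_not_dvd hpI]; exact hu
    have e6 : (p : ℤ) ^ K ≤ n₁ ^ (n + 1) := Int.le_of_dvd (by positivity) e5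
    have e7 : n₁ ^ (n + 1) ≤ n₁ ^ (N + 1) := pow_le_pow_right₀ (by omega) (by omega)
    have e8 : K < p ^ K := Nat.lt_pow_self hp.one_lt
    have e9 : (K : ℤ) = n₁ ^ (N + 1) := by
      rw [hK]; exact Int.natAbs_of_nonneg (by positivity)
    have e10 : (K : ℤ) < (p : ℤ) ^ K := by exact_mod_cast e8
    omega
  obtain ⟨n, hn, v, hv⟩ := hlarge 0
  obtain ⟨n', hn', v', hv'⟩ := hlarge 1
  have e : c₂ = n₂ ^ n' * n₂' * v' - n₂ ^ n * n₂' * v := by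
    have : (c₂ : ℝ) = n₂ ^ n' * n₂' * v' - n₂ ^ n * n₂' * v := by
      rw [← hv, ← hv']; push_cast; ring
    exact_mod_cast this
  have hd : n₂ ^ N ∣ c₂ := by
    rw [e, mul_assoc, mul_assoc]
    exact dvd_sub (Dvd.dvd.mul_right (pow_dvd_pow _ hn') _) (Dvd.dvd.mul_right (pow_dvd_pow _ hn) _)
  have hle := Int.natAbs_le_of_dvd_ne_zero hd C.hc2
  rw [Int.natAbs_pow, ← hN] at hle
  have : N < n₂.natAbs ^ N := Nat.lt_pow_self (by omega)
  omega

lemma Ctx.unif (C : Ctx p hp ρ₁ ρ₂ c D a μ c₁ c₂) {m : ℤ} (hm0 : m ≠ 0)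
    (h : ∀ y, ∃ γ ∈ Gam m, ftMeasure μ (y + γ) ≠ 0) :
    ∃ δ : ℝ, 0 < δ ∧ ∀ y, ∃ γ ∈ Gam m, δ ≤ ‖ftMeasure μ (y + γ)‖ := by
  haveI := C.hμ.1
  have hmr : (m : ℝ) ≠ 0 := by exact_mod_cast hm0
  have hK : IsCompact (Metric.closedBall (0 : V2) (|(m : ℝ)| + 1)) := isCompact_closedBall _ _
  have key : ∃ δ : ℝ, 0 < δ ∧ ∀ y ∈ Metric.closedBall (0 : V2) (|(m : ℝ)| + 1), ∃ γ ∈ Gam m, δ ≤ ‖ftMeasure μ (y + γ)‖ := by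
    refine hK.induction_on (p := fun s => ∃ δ : ℝ, 0 < δ ∧ ∀ y ∈ s, ∃ γ ∈ Gam m, δ ≤ ‖ftMeasure μ (y + γ)‖) ?_ ?_ ?_ ?_
    · exact ⟨1, one_pos, by simp⟩
    · rintro s t hst ⟨δ, h0, h1⟩
      exact ⟨δ, h0, fun y hy => h1 y (hst hy)⟩
    · rintro s t ⟨δ, h0, h1⟩ ⟨δ', h0', h1'⟩
      refine ⟨min δ δ', lt_min h0 h0', ?_⟩
      rintro y (hy | hy)
      · obtain ⟨γ, hγ, h⟩ := h1 y hy
        exact ⟨γ, hγ, (min_le_left _ _).trans h⟩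
      · obtain ⟨γ, hγ, h⟩ := h1' y hy
        exact ⟨γ, hγ, (min_le_right _ _).trans h⟩
    · intro y _
      obtain ⟨γ, hγ, hne⟩ := h y
      have hpos : 0 < ‖ftMeasure μ (y + γ)‖ := norm_pos_iff.2 hne
      refine ⟨{z | ‖ftMeasure μ (y + γ)‖ / 2 < ‖ftMeasure μ (z + γ)‖}, ?_, ‖ftMeasure μ (y + γ)‖ / 2, by positivity, fun z hz => ⟨γ, hγ, le_of_lt hz⟩⟩
      apply mem_nhdsWithin_of_mem_nhds
      have hc : Continuous (fun z : V2 => ‖ftMeasure μ (z + γ)‖) := by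
        have := ft_continuous μ
        fun_prop
      exact (isOpen_lt continuous_const hc).mem_nhds (by simp only [Set.mem_ofPred_eq]; linarith)
  obtain ⟨δ, hδ, h1⟩ := key
  refine ⟨δ, hδ, fun y => ?_⟩
  set g : V2 := fun i => if i = 0 then (m : ℝ) * (-⌊y 0 / m⌋ : ℤ) else ((-⌊y 1⌋ : ℤ) : ℝ) with hg
  have hgΓ : g ∈ Gam m := ⟨-⌊y 0 / m⌋, -⌊y 1⌋, by simp [hg], by simp [hg]⟩
  have hin : y + g ∈ Metric.closedBall (0 : V2) (|(m : ℝ)| + 1) := by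
    rw [mem_closedBall_zero_iff, pi_norm_le_iff_of_nonneg (by positivity)]
    have ha := abs_nonneg (m : ℝ)
    intro i
    rw [Real.norm_eq_abs]
    fin_cases i
    · have : (y + g) 0 = m * Int.fract (y 0 / m) := by
        simp only [hg, Pi.add_apply, if_true, Int.fract]
        push_cast
        field_simp
        ring
      change |(y + g) 0| ≤ _
      rw [this, abs_mul, abs_of_nonneg (Int.fract_nonneg (y 0 / m))]
      have := (Int.fract_lt_one (y 0 / m)).le
      nlinarith [Int.fract_nonneg (y 0 / m)]
    · have : (y + g) 1 = Int.fract (y 1) := by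
        simp only [hg, Pi.add_apply, one_ne_zero, if_false, Int.fract]
        push_cast
        ring
      change |(y + g) 1| ≤ _
      rw [this, abs_of_nonneg (Int.fract_nonneg _)]
      have := (Int.fract_lt_one (y 1)).le
      linarith
  obtain ⟨γ, hγ, h2⟩ := h1 _ hin
  exact ⟨g + γ, (Gam m).add_mem hgΓ hγ, by rwa [← add_assoc]⟩

theorem Ctx.backward (C : Ctx p hp ρ₁ ρ₂ c D a μ c₁ c₂) {ℓ : ℕ} {m n₁ n₂ : ℤ}
    (hc₂ : c₂ = (p : ℤ) ^ ℓ * m) (hm : ¬ (p : ℤ) ∣ m)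
    (hn1 : (p : ℤ) ∣ n₁) (hn2 : (p : ℤ) ∣ n₂) (h1 : ρ₁⁻¹ = n₁) (h2 : ρ₂⁻¹ = n₂)
    (hd : (p : ℤ) ^ (ℓ + 1) ∣ n₁ - n₂) : IsSpectral μ := by
  haveI := C.hμ.1
  have hp0 : (0 : ℝ) < p := by exact_mod_cast hp.pos
  have hpI : Prime (p : ℤ) := Nat.prime_iff_prime_int.1 hp
  have hm0 : m ≠ 0 := by rintro rfl; simp at hm
  obtain ⟨δ, hδ, hG⟩ := C.unif hm0 (C.exists_ne hm hn1 hn2 h1 h2)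
  choose G hGΓ hGδ using hG
  obtain ⟨n₁', hn1'⟩ := hn1
  obtain ⟨n₂', hn2'⟩ := hn2
  obtain ⟨k, hk⟩ := hd
  have r1 : (n₁ : ℝ) = p * n₁' := by exact_mod_cast hn1'
  have r2 : (n₂ : ℝ) = p * n₂' := by exact_mod_cast hn2'
  have q1 : ρ₁ * n₁ = 1 := by rw [← h1]; exact mul_inv_cancel₀ C.h10.ne'
  have q2 : ρ₂ * n₂ = 1 := by rw [← h2]; exact mul_inv_cancel₀ C.h20.ne'
  have hcm : c * m = p * k * c₁ := by
    have e1 : (c₁ : ℝ) * (n₁ - n₂) = c₂ * c := by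
      linear_combination (n₁ * n₂ : ℝ) * C.hcE - (c₁ * n₁ - c₂ * c * ρ₁ * n₁ : ℝ) * q2 + (c₁ * n₂ + c₂ * c : ℝ) * q1
    have e2 : (n₁ : ℝ) - n₂ = p ^ (ℓ + 1) * k := by exact_mod_cast hk
    have e3 : (c₂ : ℝ) = p ^ ℓ * m := by exact_mod_cast hc₂
    rw [e2, e3] at e1
    have e4 : (p : ℝ) ^ ℓ ≠ 0 := by positivity
    apply mul_left_cancel₀ e4
    linear_combination -e1
  have hcop : IsCoprime (p : ℤ) m := (Prime.coprime_iff_not_dvd hpI).2 hm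
  obtain ⟨x, z, hxz⟩ := hcop
  set w : ℤ := z * a 0 with hw
  have hmw : (m : ℝ) * w = a 0 - p * (x * a 0) := by
    have : m * w = a 0 - p * (x * a 0) := by rw [hw]; linear_combination (a 0) * hxz
    exact_mod_cast this
  set b : ℕ → V2 := fun j i => (j : ℝ) * (if i = 0 then (m : ℝ) * w else (a 1 : ℝ)) / p with hb
  have b_0 : ∀ j, b j 0 = j * (m * w) / p := fun j => by simp [hb]
  have b_1 : ∀ j, b j 1 = j * a 1 / p := fun j => by simp [hb]
  have H : Had p (mask (digitR D)) (ftMeasure μ) (Tc ρ₁ ρ₂ c) (Rc n₁ n₂ c) (Gam m) b := by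
    refine ⟨hp.one_lt, ?_, ?_, mask_zero hp _, fun ξ => mask_le hp ξ, ?_, ?_, ?_, ?_, C.recF⟩
    · intro ξ
      ext i
      fin_cases i
      · change Tc ρ₁ ρ₂ c _ 0 = ξ 0
        rw [Tc_0, Rc_0]; linear_combination (ξ 0) * q1
      · change Tc ρ₁ ρ₂ c _ 1 = ξ 1
        rw [Tc_1, Rc_0, Rc_1]; linear_combination (ξ 1) * q2 - (c * ρ₂ * ξ 0) * q1
    · ext i; simp [hb]
    · apply had_sum hp
      intro i j hi hj hij
      rw [C.zero_iff]
      refine ⟨(i : ℤ) - j, ?_, fun s => if s = 0 then -((i : ℤ) - j) * (x * a 0) else 0, fun s => ?_⟩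
      · intro hdv
        have := Int.eq_zero_of_abs_lt_dvd hdv (by rw [abs_lt]; constructor <;> omega)
        omega
      · fin_cases s
        · change b i 0 - b j 0 = _
          rw [b_0, b_0, hmw]
          simp
          field_simp
          ring
        · change b i 1 - b j 1 = _
          rw [b_1, b_1]
          simp
          ring
    · rintro ξ γ ⟨s, t, hs, ht⟩
      refine mask_per D ξ γ (fun i => if i = 0 then m * s else t) fun i => ?_
      fin_cases i
      · simpa using hs
      · simpa using ht
    · intro j
      refine ⟨n₁' * w * j, k * c₁ * j * w + n₂' * j * a 1, ?_, ?_⟩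
      · rw [Rc_0, b_0, r1]; push_cast; field_simp
      · rw [Rc_1, b_0, b_1, r2]
        have : c * (j * (m * w) / p) = (c * m) * (j * w) / p := by ring
        rw [this, hcm]
        push_cast; field_simp
    · rintro γ ⟨s, t, hs, ht⟩
      refine ⟨n₁ * s, p * k * c₁ * s + n₂ * t, ?_, ?_⟩
      · rw [Rc_0, hs]; push_cast; ring
      · rw [Rc_1, hs, ht]; push_cast; linear_combination s * hcm
  exact H.spectral hGΓ hδ hGδ C.tendsto

end

end

/-- Theorem 1.6: with `ρ₁ ≠ ρ₂` and `c'' = c₁/c₂ ∈ E_a`, `gcd(c₁,c₂)=1`,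
`c₂ = p^ℓ·m` with `p ∤ m`, `μ_{M,D}` is a spectral measure iff
`ρ₁⁻¹, ρ₂⁻¹ ∈ pℤ` and `p^{ℓ+1} ∣ (ρ₁⁻¹ − ρ₂⁻¹)`. -/
theorem stmt7 (p : ℕ) (hp : p.Prime) (ρ₁ ρ₂ c : ℝ)
    (hρ10 : 0 < ρ₁) (hρ11 : ρ₁ < 1) (hρ20 : 0 < ρ₂) (hρ21 : ρ₂ < 1) (hρ : ρ₁ ≠ ρ₂)
    (D : Fin p → (Fin 2 → ℤ)) (hD : Function.Injective D)
    (a : Fin 2 → ℤ) (hZ : ZeroSetCond p D a)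
    (hD0 : D ⟨0, hp.pos⟩ = 0)
    (hD11 : D ⟨1, hp.one_lt⟩ 1 = 0) (hD10 : D ⟨1, hp.one_lt⟩ 0 ≠ 0)
    (μ : Measure (Fin 2 → ℝ)) (hμ : IsSelfAffine μ (Mupper ρ₁ ρ₂ c) (digitR D))
    (c₁ c₂ : ℤ) (hc₁c₂ : Int.gcd c₁ c₂ = 1) (ℓ : ℕ) (m : ℤ)
    (hc₂ : c₂ = (p : ℤ) ^ ℓ * m) (hm : ¬ (p : ℤ) ∣ m)
    (hc'' : c / (ρ₁⁻¹ - ρ₂⁻¹) = (c₁ : ℝ) / (c₂ : ℝ))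
    (hE : c / (ρ₁⁻¹ - ρ₂⁻¹) ∈ Ea p a) :
    IsSpectral μ ↔
      ∃ n₁ n₂ : ℤ, (p : ℤ) ∣ n₁ ∧ (p : ℤ) ∣ n₂ ∧ ρ₁⁻¹ = (n₁ : ℝ) ∧ ρ₂⁻¹ = (n₂ : ℝ) ∧
        (p : ℤ) ^ (ℓ + 1) ∣ (n₁ - n₂) := by
  have hpI : Prime (p : ℤ) := Nat.prime_iff_prime_int.1 hp
  have hm0 : m ≠ 0 := by rintro rfl; simp at hm
  have hc20 : c₂ ≠ 0 := by
    rw [hc₂]; exact mul_ne_zero (pow_ne_zero _ hpI.ne_zero) hm0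
  have hc2r : (c₂ : ℝ) ≠ 0 := by exact_mod_cast hc20
  have hcE : (c₁ : ℝ) * (ρ₂ - ρ₁) = c₂ * c * ρ₁ * ρ₂ := by
    have h0 : ρ₁⁻¹ - ρ₂⁻¹ ≠ 0 := fun h => hρ (inv_injective (sub_eq_zero.1 h))
    rw [div_eq_div_iff h0 hc2r] at hc''
    have e1 : ρ₁⁻¹ * ρ₁ = 1 := inv_mul_cancel₀ hρ10.ne'
    have e2 : ρ₂⁻¹ * ρ₂ = 1 := inv_mul_cancel₀ hρ20.ne'
    linear_combination (-ρ₁ * ρ₂) * hc'' - c₁ * ρ₂ * e1 + c₁ * ρ₁ * e2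
  have ha : ¬ (p : ℤ) ∣ a 1 := by
    intro h
    have h1 := (hZ.1 1).1
    have h2 := (hZ.1 1).2
    have := Int.le_of_dvd (by omega) h
    omega
  have hzero : (c₁ : ℝ) / c₂ = 0 → ¬ (p : ℤ) ∣ c₂ * a 1 - c₁ * a 0 := by
    intro h
    have h1 : c₁ = 0 := by
      rw [div_eq_zero_iff] at h
      rcases h with h | h
      · exact_mod_cast h
      · exact absurd h hc2r
    subst h1
    rw [Int.gcd_zero_left] at hc₁c₂
    rw [zero_mul, sub_zero]
    intro hd
    rcases hpI.dvd_or_dvd hd with h | h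
    · have h2 : (p : ℤ) ∣ 1 := by
        have := Int.dvd_natAbs.2 h
        rwa [hc₁c₂] at this
      exact hpI.not_isUnit (isUnit_of_dvd_one h2)
    · exact ha h
  have hna : ¬ (p : ℤ) ∣ c₂ * a 1 - c₁ * a 0 := by
    rcases hE with ⟨h, l, hg, hnd, hx⟩ | h0
    · rw [hc''] at hx
      by_cases hl : l = 0
      · subst hl
        apply hzero
        rw [hx]; simp
      · have hlr : (l : ℝ) ≠ 0 := by exact_mod_cast hl
        rw [div_eq_div_iff hc2r hlr] at hx
        have hx' : c₁ * l = h * c₂ := by exact_mod_cast hx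
        have d1 : l ∣ c₂ := by
          have : l ∣ h * c₂ := ⟨c₁, by rw [← hx']; ring⟩
          exact (Int.isCoprime_iff_gcd_eq_one.2 hg).symm.dvd_of_dvd_mul_left this
        have d2 : c₂ ∣ l := by
          have : c₂ ∣ c₁ * l := ⟨h, by rw [hx']; ring⟩
          exact (Int.isCoprime_iff_gcd_eq_one.2 hc₁c₂).symm.dvd_of_dvd_mul_left this
        obtain ⟨t, ht⟩ := d1
        have hc1 : c₁ = h * t := by
          apply mul_right_cancel₀ hl
          rw [hx', ht]; ring
        intro hd
        apply hnd
        obtain ⟨s, hs⟩ := d2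
        have h1 : h = c₁ * s := by
          apply mul_right_cancel₀ hc20
          rw [← hx', hs]; ring
        refine hd.trans ⟨s, ?_⟩
        rw [hs, h1]; ring
    · apply hzero
      rw [← hc'']; exact h0
  have C : Ctx p hp ρ₁ ρ₂ c D a μ c₁ c₂ :=
    ⟨hρ10, hρ11, hρ20, hρ21, hZ, hD0, hD11, hD10, hμ, hc20, hcE, hna⟩
  constructor
  · exact C.forward hc₁c₂ ℓ m hc₂
  · rintro ⟨n₁, n₂, hn1, hn2, h1, h2, hd⟩
    exact C.backward hc₂ hm hn1 hn2 h1 h2 hd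

end
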